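/- arXiv:1207.0834 — 11 statements merged into one kernel-verified Lean document; each statement's English description precedes it below -/
import Mathlib

section
/- Let ℓ > 0, let k : ℝ → ℝ be continuous, and let M(t) be the 2×2 real matrix with first row (−1/(2ℓ), k(t)/2) and second row (−k(t)/2, 1/(2ℓ)). Suppose Φ : ℝ → Matrix(2,2,ℝ) is differentiable with Φ'(t) = M(t) · Φ(t) and Φ(0) = I. Then (a) det Φ(t) = 1 for all t; and (b) for every x₀ ∈ ℝ and every differentiable x : [0,T] → ℝ with x(0) = x₀ satisfying the Riccati equation x'(t) = (1/2)·k(t)·(x(t)² + 1) − x(t)/ℓ, if Φ₂₁(t)·x₀ + Φ₂₂(t) ≠ 0 for all t ∈ [0,T], then x(t) = (Φ₁₁(t)·x₀ + Φ₁₂(t)) / (Φ₂₁(t)·x₀ + Φ₂₂(t)) for all t ∈ [0,T]. (This expresses that the bicycle monodromy is a Möbius transformation.) -/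
open Real Set

/-- A solution of a scalar homogeneous linear equation with continuous coefficient that vanishes
at the left end of an interval vanishes on the whole interval. -/
theorem eq_zero_of_hasDerivAt_mul_self {a b : ℝ} {c w : ℝ → ℝ} (hc : ContinuousOn c (Icc a b))
    (hw : ∀ t ∈ Icc a b, HasDerivAt w (c t * w t) t) (ha : w a = 0) :
    ∀ t ∈ Icc a b, w t = 0 := by
  obtain ⟨K, hK⟩ := isCompact_Icc.exists_bound_of_continuousOn hc
  exact eq_zero_of_abs_deriv_le_mul_abs_self_of_eq_zero_right (f' := fun s => c s * w s) (K := K)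
    (fun s hs => (hw s hs).continuousAt.continuousWithinAt)
    (fun s hs => (hw s (Ico_subset_Icc_self hs)).hasDerivWithinAt) ha
    fun s hs => by
      rw [norm_mul]
      exact mul_le_mul_of_nonneg_right (hK s (Ico_subset_Icc_self hs)) (norm_nonneg _)

/-- The bicycle monodromy is a Möbius transformation: solutions of the Riccati form
of the bicycle equation are fractional-linear in their initial condition, with matrix
the fundamental solution `Φ` of the associated linear system, which has determinant 1. -/
theorem bicycle_monodromy_moebius
    (ℓ : ℝ) (hℓ : 0 < ℓ) (k : ℝ → ℝ) (hk : Continuous k)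
    (M : ℝ → Matrix (Fin 2) (Fin 2) ℝ)
    (hM : ∀ t, M t = !![-1 / (2 * ℓ), k t / 2; -(k t) / 2, 1 / (2 * ℓ)])
    (Φ : ℝ → Matrix (Fin 2) (Fin 2) ℝ)
    (hΦ : ∀ t i j, HasDerivAt (fun s => Φ s i j) ((M t * Φ t) i j) t)
    (hΦ0 : Φ 0 = 1) :
    (∀ t, (Φ t).det = 1) ∧
    (∀ (x₀ T : ℝ) (x : ℝ → ℝ), x 0 = x₀ →
      (∀ t ∈ Icc (0 : ℝ) T,
        HasDerivAt x ((1 / 2) * k t * ((x t) ^ 2 + 1) - x t / ℓ) t) →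
      (∀ t ∈ Icc (0 : ℝ) T, Φ t 1 0 * x₀ + Φ t 1 1 ≠ 0) →
      ∀ t ∈ Icc (0 : ℝ) T,
        x t = (Φ t 0 0 * x₀ + Φ t 0 1) / (Φ t 1 0 * x₀ + Φ t 1 1)) := by
  have h00 := fun t => hΦ t 0 0
  have h01 := fun t => hΦ t 0 1
  have h10 := fun t => hΦ t 1 0
  have h11 := fun t => hΦ t 1 1
  simp only [hM, Matrix.mul_apply, Fin.sum_univ_two, Matrix.of_apply, Matrix.cons_val_zero,
    Matrix.cons_val_one, Matrix.cons_val', Matrix.cons_val_fin_one] at h00 h01 h10 h11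
  refine ⟨fun t => ?_, fun x₀ T x hx0 hx hne t ht => ?_⟩
  · have hdet : ∀ s, HasDerivAt (fun r => (Φ r).det) 0 s := fun s => by
      simp only [Matrix.det_fin_two]
      refine (((h00 s).mul (h11 s)).sub ((h01 s).mul (h10 s))).congr_deriv ?_
      ring
    rw [is_const_of_deriv_eq_zero (fun s => (hdet s).differentiableAt) (fun s => (hdet s).deriv) t 0,
      hΦ0, Matrix.det_one]
  · have hcont : ContinuousOn (fun s => k s * x s / 2 - 1 / (2 * ℓ)) (Icc 0 T) :=
      ((hk.continuousOn.mul fun s hs => (hx s hs).continuousAt.continuousWithinAt).div_const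
        2).sub continuousOn_const
    have hw := eq_zero_of_hasDerivAt_mul_self
      (w := fun s => (Φ s 0 0 * x₀ + Φ s 0 1) - x s * (Φ s 1 0 * x₀ + Φ s 1 1)) hcont
      (fun s hs => by
        refine ((((h00 s).mul_const x₀).add (h01 s)).sub
          ((hx s hs).mul (((h10 s).mul_const x₀).add (h11 s)))).congr_deriv ?_
        simp only [Pi.add_apply]
        field_simp
        ring)
      (by simp [hΦ0, hx0]) t ht
    rw [eq_div_iff (hne t ht)]
    exact (sub_eq_zero.mp hw).symm
end

section
/- Let ℓ > 0 and let ψ, θ : ℝ → ℝ be differentiable. Let F : ℝ → ℝ² be differentiable with F'(t) = (cos ψ(t), sin ψ(t)) for all t (a unit-speed front track with tangent angle ψ), set k = ψ' (the curvature of F), and define the rear track R(t) = F(t) − ℓ·(cos θ(t), sin θ(t)). Assume the bicycle constraint holds: −sin(θ(t))·R₁'(t) + cos(θ(t))·R₂'(t) = 0 for all t (i.e., R' is parallel to the frame direction (cos θ, sin θ)). Then the steering angle α = ψ − θ satisfies the bicycle equation α'(t) = k(t) − sin(α(t))/ℓ for all t. -/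
open Real Set

/-- The steering angle `α = ψ − θ` of a bicycle of length `ℓ` whose unit-speed front
track has tangent angle `ψ` (and curvature `k = ψ'`) satisfies the bicycle equation
`α' = k − sin α / ℓ`, given the bicycle constraint on the rear track `R = F − ℓ(cos θ, sin θ)`. -/
theorem bicycle_equation
    (ℓ : ℝ) (hℓ : 0 < ℓ)
    (ψ θ ψ' θ' : ℝ → ℝ)
    (hψ : ∀ t, HasDerivAt ψ (ψ' t) t)
    (hθ : ∀ t, HasDerivAt θ (θ' t) t)
    (F : ℝ → EuclideanSpace ℝ (Fin 2))
    (hF0 : ∀ t, HasDerivAt (fun s => F s 0) (Real.cos (ψ t)) t)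
    (hF1 : ∀ t, HasDerivAt (fun s => F s 1) (Real.sin (ψ t)) t)
    (R : ℝ → EuclideanSpace ℝ (Fin 2))
    (hR0 : ∀ t, R t 0 = F t 0 - ℓ * Real.cos (θ t))
    (hR1 : ∀ t, R t 1 = F t 1 - ℓ * Real.sin (θ t))
    (R' : ℝ → EuclideanSpace ℝ (Fin 2))
    (hR'0 : ∀ t, HasDerivAt (fun s => R s 0) (R' t 0) t)
    (hR'1 : ∀ t, HasDerivAt (fun s => R s 1) (R' t 1) t)
    (constraint : ∀ t, -Real.sin (θ t) * R' t 0 + Real.cos (θ t) * R' t 1 = 0) :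
    ∀ t, HasDerivAt (fun s => ψ s - θ s)
      (ψ' t - Real.sin (ψ t - θ t) / ℓ) t := by
  intro t
  have h0 : R' t 0 = Real.cos (ψ t) - ℓ * (-Real.sin (θ t) * θ' t) := by
    refine (hR'0 t).unique ?_
    rw [funext hR0]
    exact (hF0 t).sub ((hθ t).cos.const_mul ℓ)
  have h1 : R' t 1 = Real.sin (ψ t) - ℓ * (Real.cos (θ t) * θ' t) := by
    refine (hR'1 t).unique ?_
    rw [funext hR1]
    exact (hF1 t).sub ((hθ t).sin.const_mul ℓ)
  have hc := constraint t
  rw [h0, h1] at hc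
  have h_turn : Real.sin (ψ t - θ t) / ℓ = θ' t := by
    rw [div_eq_iff hℓ.ne', Real.sin_sub]
    linear_combination hc + ℓ * θ' t * Real.sin_sq_add_cos_sq (θ t)
  rw [h_turn]
  exact (hψ t).sub (hθ t)
end

section
/- Let ℓ > 0, T > 0, let k : ℝ → ℝ be continuous, and let α : [0,T] → ℝ be a differentiable solution of the bicycle equation α'(t) = k(t) − sin(α(t))/ℓ with α(T) − α(0) ∈ 2πℤ (a fixed point of the monodromy, corresponding to a closed rear track). Let L = ∫₀ᵀ cos(α(t)) dt (the signed length of the rear track). Then every differentiable solution β : [0,T] → ℝ of the linearized (variational) equation β'(t) = −(cos(α(t))/ℓ)·β(t) satisfies β(T) = β(0)·exp(−L/ℓ). (Thus the derivative of the bicycle monodromy at this fixed point equals e^{−L/ℓ}.) -/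
open Real Set intervalIntegral

/-- Solutions of the scalar linear equation `y' = c y` on a compact interval are given by
the exponential of the integral of `c`. -/
theorem eq_mul_exp_integral_of_hasDerivAt {a b : ℝ} (hab : a ≤ b) {c y : ℝ → ℝ}
    (hc : ContinuousOn c (Icc a b)) (hy : ∀ t ∈ Icc a b, HasDerivAt y (c t * y t) t) :
    y b = y a * Real.exp (∫ t in a..b, c t) := by
  set d : ℝ → ℝ := IccExtend hab ((Icc a b).domRestrict c) with hd
  have hdc : Continuous d := hc.domRestrict.Icc_extend'
  have hd_eq : ∀ t ∈ Icc a b, d t = c t := fun t ht => by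
    rw [hd, IccExtend_of_mem hab _ ht, domRestrict_apply]
  have hF : ∀ t ∈ Icc a b,
      HasDerivAt (fun t => y t * Real.exp (-∫ s in a..t, d s)) 0 t := fun t ht => by
    have hG : HasDerivAt (fun t => ∫ s in a..t, d s) (d t) t :=
      hdc.integral_hasStrictDerivAt a t |>.hasDerivAt
    refine ((hy t ht).mul hG.neg.exp).congr_deriv ?_
    rw [hd_eq t ht]
    ring
  have hconst := constant_of_has_deriv_right_zero
    (fun t ht => (hF t ht).continuousAt.continuousWithinAt)
    (fun t ht => (hF t (Ico_subset_Icc_self ht)).hasDerivWithinAt) b (right_mem_Icc.2 hab)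
  have hint : ∫ s in a..b, d s = ∫ s in a..b, c s :=
    integral_congr fun t ht => hd_eq t (by rwa [uIcc_of_le hab] at ht)
  simp only [integral_same, neg_zero, Real.exp_zero, mul_one, hint] at hconst
  rw [← hconst, mul_assoc, ← Real.exp_add, neg_add_cancel, Real.exp_zero, mul_one]

/-- The derivative of the bicycle monodromy at a fixed point (closed rear track) is
`e^{−L/ℓ}`, where `L = ∫₀ᵀ cos α` is the signed length of the rear track: every solution
of the variational equation `β' = −(cos α / ℓ)·β` satisfies `β(T) = β(0)·e^{−L/ℓ}`. -/
theorem monodromy_derivative_at_fixed_point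
    (ℓ : ℝ) (hℓ : 0 < ℓ) (T : ℝ) (hT : 0 < T)
    (k : ℝ → ℝ) (hk : Continuous k)
    (α : ℝ → ℝ)
    (hα : ∀ t ∈ Icc (0 : ℝ) T, HasDerivAt α (k t - Real.sin (α t) / ℓ) t)
    (hper : ∃ n : ℤ, α T - α 0 = 2 * Real.pi * n)
    (L : ℝ) (hL : L = ∫ t in (0 : ℝ)..T, Real.cos (α t)) :
    ∀ β : ℝ → ℝ,
      (∀ t ∈ Icc (0 : ℝ) T, HasDerivAt β (-(Real.cos (α t) / ℓ) * β t) t) →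
      β T = β 0 * Real.exp (-L / ℓ) := by
  intro β hβ
  have hcont : ContinuousOn (fun t => -(Real.cos (α t) / ℓ)) (Icc 0 T) := fun t ht =>
    ((Real.continuous_cos.continuousAt.comp (hα t ht).continuousAt).div_const ℓ).neg
      |>.continuousWithinAt
  rw [eq_mul_exp_integral_of_hasDerivAt hT.le hcont hβ, integral_neg, integral_div, ← hL,
    neg_div]
end

section
/- Let p > q ≥ 1 be integers and let k = p/√(p² − q²). Then every differentiable solution α : ℝ → ℝ of the autonomous bicycle equation α'(t) = k − sin(α(t)) satisfies α(t + T) = α(t) + 2πq for all t, where T = 2πp/k = 2π√(p² − q²). (Thus when the front track is a circle of curvature p/√(p² − q²) traversed p times, the monodromy of the unit-length bicycle is the identity.) -/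
open Real

/-- An antiderivative of `ω / (k - sin x)`, defined on all of `ℝ`, where `ω = √(k² - 1)`. -/
noncomputable def bicyclePhase (k ω x : ℝ) : ℝ :=
  x - 2 * Real.arctan (Real.cos x / (k + ω - Real.sin x))

theorem hasDerivAt_bicyclePhase {k ω : ℝ} (hk : 1 < k) (hω : 0 < ω) (h : ω ^ 2 = k ^ 2 - 1)
    (x : ℝ) : HasDerivAt (bicyclePhase k ω) (ω / (k - Real.sin x)) x := by
  have hs := Real.sin_le_one x
  have h1 : 0 < k - Real.sin x := by linarith
  have h2 : 0 < k + ω - Real.sin x := by linarith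
  have hd := (hasDerivAt_id x).sub ((((Real.hasDerivAt_cos x).div
    ((Real.hasDerivAt_sin x).const_sub (k + ω)) h2.ne').arctan).const_mul 2)
  refine hd.congr_deriv ?_
  have hc := Real.sin_sq_add_cos_sq x
  have h4 : (k + ω - Real.sin x) ^ 2 + Real.cos x ^ 2 = 2 * (k + ω) * (k - Real.sin x) := by
    linear_combination hc + h
  have h5 : 1 + (Real.cos x / (k + ω - Real.sin x)) ^ 2 =
      2 * (k + ω) * (k - Real.sin x) / (k + ω - Real.sin x) ^ 2 := by
    rw [← h4]
    field_simp
  have h6 : 0 < k + ω := by linarith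
  simp only [Pi.div_apply]
  rw [h5]
  field_simp
  linear_combination -hc - h

theorem strictMono_bicyclePhase {k ω : ℝ} (hk : 1 < k) (hω : 0 < ω) (h : ω ^ 2 = k ^ 2 - 1) :
    StrictMono (bicyclePhase k ω) := by
  refine strictMono_of_deriv_pos fun x => ?_
  rw [(hasDerivAt_bicyclePhase hk hω h x).deriv]
  exact div_pos hω (by linarith [Real.sin_le_one x])

theorem bicyclePhase_add_nat_mul_two_pi (k ω x : ℝ) (n : ℕ) :
    bicyclePhase k ω (x + n * (2 * Real.pi)) = bicyclePhase k ω x + n * (2 * Real.pi) := by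
  simp only [bicyclePhase, Real.cos_add_nat_mul_two_pi, Real.sin_add_nat_mul_two_pi]
  ring

/-- Along a solution of the bicycle equation the phase grows linearly with speed `ω`. -/
theorem bicyclePhase_solution_add {k ω : ℝ} (hk : 1 < k) (hω : 0 < ω) (h : ω ^ 2 = k ^ 2 - 1)
    {α : ℝ → ℝ} (hα : ∀ t, HasDerivAt α (k - Real.sin (α t)) t) (t s : ℝ) :
    bicyclePhase k ω (α (t + s)) = bicyclePhase k ω (α t) + ω * s := by
  have hd : ∀ u, HasDerivAt (fun u => bicyclePhase k ω (α u) - ω * u) 0 u := fun u => by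
    have hpos : k - Real.sin (α u) ≠ 0 := by linarith [Real.sin_le_one (α u)]
    refine (((hasDerivAt_bicyclePhase hk hω h (α u)).comp u (hα u)).sub
      ((hasDerivAt_id u).const_mul ω)).congr_deriv ?_
    field_simp
    ring
  have hconst := is_const_of_deriv_eq_zero (fun u => (hd u).differentiableAt)
    (fun u => (hd u).deriv) (t + s) t
  linear_combination hconst

/-- When the front track is a circle of curvature `k = p/√(p² − q²)` traversed `p` times
(time interval `T = 2πp/k = 2π√(p² − q²)`), the monodromy of the unit-length bicycle is
the identity: every solution of `α' = k − sin α` advances by exactly `2πq` over time `T`. -/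
theorem circle_identity_monodromy
    (p q : ℕ) (hq : 1 ≤ q) (hpq : q < p)
    (k : ℝ) (hk : k = (p : ℝ) / Real.sqrt ((p : ℝ) ^ 2 - (q : ℝ) ^ 2))
    (α : ℝ → ℝ)
    (hα : ∀ t, HasDerivAt α (k - Real.sin (α t)) t) :
    ∀ t, α (t + 2 * Real.pi * Real.sqrt ((p : ℝ) ^ 2 - (q : ℝ) ^ 2))
      = α t + 2 * Real.pi * q := by
  intro t
  have hq0 : (0 : ℝ) < q := by exact_mod_cast hq
  have hpq' : (q : ℝ) < p := by exact_mod_cast hpq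
  have hpos : 0 < (p : ℝ) ^ 2 - (q : ℝ) ^ 2 := by nlinarith
  have hsq := Real.sq_sqrt hpos.le
  have hr := Real.sqrt_pos.2 hpos
  set r := Real.sqrt ((p : ℝ) ^ 2 - (q : ℝ) ^ 2)
  have hk1 : 1 < k := by
    rw [hk, one_lt_div hr]
    nlinarith
  have hω : 0 < (q : ℝ) / r := div_pos hq0 hr
  have h : ((q : ℝ) / r) ^ 2 = k ^ 2 - 1 := by
    rw [hk]
    field_simp
    linear_combination hsq
  apply (strictMono_bicyclePhase hk1 hω h).injective
  rw [bicyclePhase_solution_add hk1 hω h hα, mul_comm (2 * Real.pi) (q : ℝ),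
    bicyclePhase_add_nat_mul_two_pi]
  field_simp
end

section
/- Let ℓ > 0, T > 0, and let k : [0,T] → ℝ be continuous with k(t) > 0 for all t and ∫₀ᵀ k(t) dt = 2π. Define the tangent angle ψ(t) = ∫₀ᵗ k(s) ds and assume ∫₀ᵀ cos(ψ(t)) dt = 0 and ∫₀ᵀ sin(ψ(t)) dt = 0 (so that k is the curvature of a C¹-closed strictly convex plane curve traversed once). Then the bicycle monodromy is not the identity: there exists a differentiable solution α : [0,T] → ℝ of the bicycle equation α'(t) = k(t) − sin(α(t))/ℓ with α(T) − α(0) ∉ 2πℤ. -/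
open Real Set intervalIntegral

/-- `α` solves the bicycle equation with length `ℓ` and curvature `k` on `[0, T]`. -/
def IsBicycleSolution (ℓ T : ℝ) (k α : ℝ → ℝ) : Prop :=
  ∀ t ∈ Icc (0 : ℝ) T, HasDerivAt α (k t - Real.sin (α t) / ℓ) t

/-- A function whose derivative is a positive multiple of a strictly increasing function is
negative between two consecutive zeros. -/
lemma neg_of_deriv_eq_pos_mul_strictMono {a b : ℝ} {Z w M : ℝ → ℝ}
    (hZc : ContinuousOn Z (Icc a b))
    (hZ : ∀ t ∈ Ioo a b, HasDerivAt Z (w t * M t) t) (hw : ∀ t ∈ Ioo a b, 0 < w t)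
    (hM : StrictMonoOn M (Ioo a b)) (ha : Z a = 0) (hb : Z b = 0) :
    ∀ t ∈ Ioo a b, Z t < 0 := by
  intro t ht
  obtain ⟨c, hc, hc'⟩ := exists_hasDerivAt_eq_slope Z (fun t => w t * M t) ht.1
    (hZc.mono (Icc_subset_Icc_right ht.2.le)) fun s hs => hZ s ⟨hs.1, hs.2.trans ht.2⟩
  obtain ⟨d, hd, hd'⟩ := exists_hasDerivAt_eq_slope Z (fun t => w t * M t) ht.2
    (hZc.mono (Icc_subset_Icc_left ht.1.le)) fun s hs => hZ s ⟨ht.1.trans hs.1, hs.2⟩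
  have hcI : c ∈ Ioo a b := ⟨hc.1, hc.2.trans ht.2⟩
  have hdI : d ∈ Ioo a b := ⟨ht.1.trans hd.1, hd.2⟩
  by_contra! h
  have h1 : 0 ≤ w c * M c := by
    rw [hc', ha, sub_zero]; exact div_nonneg h (sub_nonneg.2 ht.1.le)
  have h2 : w d * M d ≤ 0 := by
    rw [hd', hb, zero_sub]
    exact div_nonpos_of_nonpos_of_nonneg (neg_nonpos.2 h) (sub_nonneg.2 ht.2.le)
  have h3 : 0 ≤ M c := nonneg_of_mul_nonneg_right h1 (hw c hcI)
  have h4 : M d ≤ 0 := nonpos_of_mul_nonpos_right h2 (hw d hdI)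
  have h5 := hM hcI hdI (hc.2.trans hd.1)
  linarith

/-- The bicycle equation has a solution on `[0, T]` starting at `0`. -/
lemma exists_isBicycleSolution {ℓ T : ℝ} (hℓ : 0 < ℓ) (hT : 0 ≤ T) {k : ℝ → ℝ}
    (hk : Continuous k) :
    ∃ α : ℝ → ℝ, Continuous α ∧ α 0 = 0 ∧ IsBicycleSolution ℓ T k α := by
  obtain ⟨B, hB⟩ := isCompact_Icc.exists_bound_of_continuousOn (s := Icc 0 T) hk.continuousOn
  have hB0 : 0 ≤ B := (norm_nonneg _).trans (hB 0 ⟨le_rfl, hT⟩)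
  have hL : 0 ≤ B + 1 / ℓ := by positivity
  have hpl : IsPicardLindelof (fun t a => k t - Real.sin a / ℓ)
      (⟨0, le_rfl, hT⟩ : Icc (0 : ℝ) T) 0 ⟨(B + 1 / ℓ) * T, by positivity⟩ 0 ⟨B + 1 / ℓ, hL⟩
      ⟨1 / ℓ, by positivity⟩ := by
    refine ⟨fun t _ => ?_, fun a _ => by fun_prop, fun t ht a _ => ?_, ?_⟩
    · refine LipschitzOnWith.of_dist_le_mul fun a _ b _ => ?_
      have h : |Real.sin b - Real.sin a| ≤ |b - a| := by
        have := Real.lipschitzWith_sin.dist_le_mul b a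
        simpa [Real.dist_eq] using this
      simp only [Real.dist_eq]
      calc |k t - Real.sin a / ℓ - (k t - Real.sin b / ℓ)|
          = |(Real.sin b - Real.sin a) / ℓ| := by congr 1; ring
        _ = |Real.sin b - Real.sin a| / ℓ := by rw [abs_div, abs_of_pos hℓ]
        _ ≤ |b - a| / ℓ := by gcongr
        _ = 1 / ℓ * |a - b| := by rw [abs_sub_comm]; ring
    · refine (norm_sub_le _ _).trans (add_le_add (hB t ht) ?_)
      rw [Real.norm_eq_abs, abs_div, abs_of_pos hℓ]
      gcongr
      exact Real.abs_sin_le_one a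
    · simp only [sub_zero, sub_self, max_eq_left hT, NNReal.coe_zero]
      exact le_rfl
  obtain ⟨a, ha0, ha⟩ := hpl.exists_eq_forall_mem_Icc_hasDerivWithinAt₀
  have hac : ContinuousOn a (Icc 0 T) := fun t ht => (ha t ht).continuousWithinAt
  set b : ℝ → ℝ := IccExtend hT ((Icc 0 T).domRestrict a) with hb
  have hbc : Continuous b := hac.domRestrict.Icc_extend'
  have hba : ∀ t ∈ Icc 0 T, b t = a t := fun t ht => by
    rw [hb, IccExtend_of_mem _ _ ht]; rfl
  have hfc : Continuous fun t => k t - Real.sin (b t) / ℓ := by fun_prop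
  set α : ℝ → ℝ := fun t => ∫ s in (0 : ℝ)..t, (k s - Real.sin (b s) / ℓ) with hα
  have hαd : ∀ t, HasDerivAt α (k t - Real.sin (b t) / ℓ) t := fun t =>
    hfc.integral_hasStrictDerivAt 0 t |>.hasDerivAt
  have hαa : ∀ t ∈ Icc 0 T, α t = a t := by
    intro t ht
    have := integral_eq_sub_of_hasDeriv_right_of_le (f := a)
      (f' := fun s => k s - Real.sin (b s) / ℓ) ht.1 (hac.mono (Icc_subset_Icc_right ht.2))
      (fun s hs => by
        have hs' : s ∈ Ico 0 T := ⟨hs.1.le, hs.2.trans_le ht.2⟩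
        have h := ha s ⟨hs'.1, hs'.2.le⟩
        rw [← hba s ⟨hs'.1, hs'.2.le⟩] at h
        exact (h.hasDerivAt (Icc_mem_nhds hs.1 hs'.2)).hasDerivWithinAt)
      (hfc.intervalIntegrable _ _)
    simp only [hα, this]
    rw [show a 0 = 0 from ha0, sub_zero]
  refine ⟨α, continuous_iff_continuousAt.2 fun t => (hαd t).continuousAt, by simp [hα], ?_⟩
  intro t ht
  rw [hαa t ht, ← hba t ht]
  exact hαd t

namespace IsBicycleSolution

variable {ℓ T : ℝ} {k α : ℝ → ℝ}

lemma continuousOn (h : IsBicycleSolution ℓ T k α) : ContinuousOn α (Icc 0 T) :=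
  fun t ht => (h t ht).continuousAt.continuousWithinAt

/-- The steering angle crosses the multiples of `π` only upwards. -/
lemma lt_of_sin_eq_zero (h : IsBicycleSolution ℓ T k α) (hk : ∀ t, 0 < k t) {s t : ℝ}
    (hs : 0 ≤ s) (hst : s < t) (ht : t ≤ T) (h0 : Real.sin (α s) = 0) : α s < α t := by
  have hle : ∀ u ∈ Icc s t, α s ≤ α u := by
    intro u hu
    have := image_le_of_deriv_right_lt_deriv_boundary' (f := fun _ => α s) (f' := fun _ => 0)
      (B := α) (B' := fun t => k t - Real.sin (α t) / ℓ) continuousOn_const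
      (fun x _ => hasDerivWithinAt_const _ _ _) le_rfl
      (h.continuousOn.mono (Icc_subset_Icc hs ht))
      (fun x hx => (h x ⟨hs.trans hx.1, hx.2.le.trans ht⟩).hasDerivWithinAt)
      (fun x _ hx => by simpa [← hx, h0] using hk x) hu
    exact this
  refine (hle t ⟨hst.le, le_rfl⟩).lt_of_ne fun heq => ?_
  have hd : HasDerivAt (fun u => α u - α s) (k t) t := by
    have := (h t ⟨hs.trans hst.le, ht⟩).sub_const (α s)
    rwa [← heq, h0, zero_div, sub_zero] at this
  have hev := eventually_nhdsWithin_sign_eq_of_deriv_pos (by rw [hd.deriv]; exact hk t)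
    (by simp [← heq])
  have hl : ∀ᶠ u in nhdsWithin t (Iio t), u ∈ Ioo s t := Ioo_mem_nhdsLT hst
  obtain ⟨u, hu, hus⟩ := ((hev.filter_mono nhdsWithin_le_nhds).and hl).exists
  rw [sign_neg (sub_neg.2 hus.2), sign_eq_neg_one_iff] at hu
  linarith [hle u ⟨hus.1.le, hus.2.le⟩]

/-- In half-plane coordinates `(x, y)` adapted to one solution, the angle towards any ideal
point `c` is again a solution. -/
lemma of_ideal_point (h : IsBicycleSolution ℓ T k α) {x y : ℝ → ℝ} (hy0 : ∀ t, 0 < y t)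
    (hx : ∀ t, HasDerivAt x (y t * Real.sin (α t) / ℓ) t)
    (hy : ∀ t, HasDerivAt y (-(y t * Real.cos (α t) / ℓ)) t) (c : ℝ) :
    IsBicycleSolution ℓ T k fun t => α t + Real.pi - 2 * Real.arctan ((c - x t) / y t) := by
  intro t ht
  have hyt := (hy0 t).ne'
  have hq : HasDerivAt (fun t => (c - x t) / y t)
      (((c - x t) / y t * Real.cos (α t) - Real.sin (α t)) / ℓ) t := by
    refine (((hx t).const_sub c).div (hy t) hyt).congr_deriv ?_
    field_simp
    ring
  refine (((h t ht).add_const Real.pi).sub (hq.arctan.const_mul 2)).congr_deriv ?_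
  set q := (c - x t) / y t
  have hq1 : 1 + q ^ 2 ≠ 0 := by positivity
  have hs : Real.sin (α t + Real.pi - 2 * Real.arctan q) =
      -Real.sin (α t) * (2 / (1 + q ^ 2) - 1) + Real.cos (α t) * (2 * q / (1 + q ^ 2)) := by
    have h2 : Real.cos (Real.arctan q) ^ 2 = 1 / (1 + q ^ 2) := Real.cos_sq_arctan q
    have h3 : Real.sin (Real.arctan q) = q * Real.cos (Real.arctan q) := by
      rw [← Real.tan_mul_cos (Real.cos_arctan_pos q).ne', Real.tan_arctan]
    rw [show α t + Real.pi - 2 * Real.arctan q = α t - 2 * Real.arctan q + Real.pi by ring,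
      Real.sin_add_pi, Real.sin_sub, Real.sin_two_mul, Real.cos_two_mul, h3]
    linear_combination (-2 * Real.sin (α t) + 2 * q * Real.cos (α t)) * h2
  rw [hs]
  rcases eq_or_ne ℓ 0 with rfl | hℓ
  · simp
  field_simp
  ring

/-- If the monodromy is trivial, the curve in the half-plane closes up. -/
lemma closed_of_trivial_monodromy (h : IsBicycleSolution ℓ T k α) {x y : ℝ → ℝ}
    (hy0 : ∀ t, 0 < y t)
    (hx : ∀ t, HasDerivAt x (y t * Real.sin (α t) / ℓ) t)
    (hy : ∀ t, HasDerivAt y (-(y t * Real.cos (α t) / ℓ)) t)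
    (hx1 : x 0 = 0) (hy1 : y 0 = 1)
    (hall : ∀ β, IsBicycleSolution ℓ T k β → ∃ n : ℤ, β T - β 0 = 2 * Real.pi * n) :
    x T = 0 ∧ y T = 1 := by
  have key : ∀ c : ℝ, (c - x T) / y T = c := by
    intro c
    obtain ⟨m, hm⟩ := hall α h
    obtain ⟨n, hn⟩ := hall _ (h.of_ideal_point hy0 hx hy c)
    simp only [hx1, hy1, sub_zero, div_one] at hn
    have hd : Real.arctan ((c - x T) / y T) - Real.arctan c = Real.pi * ((m - n : ℤ) : ℝ) := by
      push_cast
      linarith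
    have h1 := Real.neg_pi_div_two_lt_arctan ((c - x T) / y T)
    have h2 := Real.arctan_lt_pi_div_two ((c - x T) / y T)
    have h3 := Real.neg_pi_div_two_lt_arctan c
    have h4 := Real.arctan_lt_pi_div_two c
    have h5 : m - n < 1 := by
      have : ((m - n : ℤ) : ℝ) < 1 := by
        by_contra! hc
        nlinarith [Real.pi_pos]
      exact_mod_cast this
    have h6 : -1 < m - n := by
      have : (-1 : ℝ) < ((m - n : ℤ) : ℝ) := by
        by_contra! hc
        nlinarith [Real.pi_pos]
      exact_mod_cast this
    rw [show m - n = 0 by omega, Int.cast_zero, mul_zero, sub_eq_zero] at hd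
    exact Real.arctan_injective hd
  have hyT := (hy0 T).ne'
  have hx0 : x T = 0 := by
    have := key 0
    rw [div_eq_iff hyT] at this
    linarith
  refine ⟨hx0, ?_⟩
  have := key 1
  rw [div_eq_iff hyT, hx0] at this
  linarith

/-- The area comparison: a convex closed curve in the half-plane that turns once relative to
the ideal point at infinity has total curvature more than `2π`. -/
lemma two_pi_lt_of_closed (h : IsBicycleSolution ℓ T k α) (hℓ : 0 < ℓ) (hT : 0 < T)
    (hk : ∀ t, 0 < k t) (hαc : Continuous α) {x y K : ℝ → ℝ} (hy0 : ∀ t, 0 < y t)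
    (hx : ∀ t, HasDerivAt x (y t * Real.sin (α t) / ℓ) t)
    (hy : ∀ t, HasDerivAt y (-(y t * Real.cos (α t) / ℓ)) t)
    (hK : ∀ t, HasDerivAt K (k t) t) (hx1 : x 0 = 0) (hy1 : y 0 = 1) (hxT : x T = 0)
    (hyT : y T = 1) (hα0 : α 0 = 0) (hαT : α T = 2 * Real.pi) :
    2 * Real.pi < K T - K 0 := by
  have hxc : Continuous x := continuous_iff_continuousAt.2 fun t => (hx t).continuousAt
  have hyc : Continuous y := continuous_iff_continuousAt.2 fun t => (hy t).continuousAt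
  have hpi := Real.pi_pos
  obtain ⟨s, hs, hαs⟩ : ∃ s ∈ Ioo 0 T, α s = Real.pi :=
    intermediate_value_Ioo hT.le hαc.continuousOn (by rw [hα0, hαT]; constructor <;> linarith)
  have hsin1 : ∀ t ∈ Ioo 0 s, 0 < Real.sin (α t) := by
    intro t ht
    refine Real.sin_pos_of_mem_Ioo ⟨?_, ?_⟩
    · have := h.lt_of_sin_eq_zero hk le_rfl ht.1 (ht.2.trans hs.2).le (by simp [hα0])
      rwa [hα0] at this
    · by_contra! hc
      obtain ⟨u, hu, hαu⟩ : ∃ u ∈ Icc 0 t, α u = Real.pi :=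
        intermediate_value_Icc ht.1.le hαc.continuousOn (by rw [hα0]; exact ⟨hpi.le, hc⟩)
      have := h.lt_of_sin_eq_zero hk hu.1 (hu.2.trans_lt ht.2) hs.2.le (by simp [hαu])
      linarith
  have hsin2 : ∀ t ∈ Ioo s T, Real.sin (α t) < 0 := by
    intro t ht
    have h1 : Real.pi < α t := by
      have := h.lt_of_sin_eq_zero hk hs.1.le ht.1 ht.2.le (by simp [hαs])
      rwa [hαs] at this
    have h2 : α t < 2 * Real.pi := by
      by_contra! hc
      obtain ⟨u, hu, hαu⟩ : ∃ u ∈ Icc s t, α u = 2 * Real.pi :=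
        intermediate_value_Icc ht.1.le hαc.continuousOn
          (by rw [hαs]; exact ⟨by linarith, hc⟩)
      have := h.lt_of_sin_eq_zero hk (hs.1.le.trans hu.1) (hu.2.trans_lt ht.2) le_rfl
        (by simp [hαu])
      linarith
    have := Real.sin_pos_of_mem_Ioo (x := α t - Real.pi) ⟨by linarith, by linarith⟩
    rw [Real.sin_sub_pi] at this
    linarith
  -- the orthogonal projection to the ideal boundary of the tangent geodesics moves monotonically
  have hM : ∀ t ∈ Icc 0 T, Real.sin (α t) ≠ 0 → ∀ c,
      HasDerivAt (fun t => x t - c - y t * Real.cos (α t) / Real.sin (α t))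
        (y t * k t / Real.sin (α t) ^ 2) t := by
    intro t ht hst c
    refine (((hx t).sub_const c).sub (((hy t).mul (h t ht).cos).div (h t ht).sin hst)).congr_deriv
      ?_
    have hsc := Real.sin_sq_add_cos_sq (α t)
    simp only [Pi.mul_apply]
    field_simp
    linear_combination (y t * k t * ℓ) * hsc
  have hMmono : ∀ a b c, 0 ≤ a → b ≤ T → (∀ t ∈ Ioo a b, Real.sin (α t) ≠ 0) →
      StrictMonoOn (fun t => x t - c - y t * Real.cos (α t) / Real.sin (α t)) (Ioo a b) := by
    intro a b c ha hb hab
    have hd : ∀ t ∈ Ioo a b, _ := fun t ht =>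
      hM t ⟨ha.trans ht.1.le, ht.2.le.trans hb⟩ (hab t ht) c
    refine strictMonoOn_of_deriv_pos (convex_Ioo a b)
      (fun t ht => (hd t ht).continuousAt.continuousWithinAt) fun t ht => ?_
    rw [interior_Ioo] at ht
    rw [(hd t ht).deriv]
    have := hab t ht
    have := hy0 t
    have := hk t
    positivity
  have hxmono : StrictMonoOn x (Icc 0 s) := by
    refine strictMonoOn_of_deriv_pos (convex_Icc 0 s) hxc.continuousOn fun t ht => ?_
    rw [interior_Icc] at ht
    rw [(hx t).deriv]
    have := hy0 t
    have := hsin1 t ht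
    positivity
  have hxanti : StrictAntiOn x (Icc s T) := by
    refine strictAntiOn_of_deriv_neg (convex_Icc s T) hxc.continuousOn fun t ht => ?_
    rw [interior_Icc] at ht
    rw [(hx t).deriv]
    exact div_neg_of_neg_of_pos (mul_neg_of_pos_of_neg (hy0 t) (hsin2 t ht)) hℓ
  have hxs : 0 < x s := by
    have := hxmono ⟨le_rfl, hs.1.le⟩ ⟨hs.1.le, le_rfl⟩ hs.1
    rwa [hx1] at this
  have hxI : ∀ t ∈ Icc 0 T, 0 ≤ x t ∧ x t ≤ x s := by
    intro t ht
    rcases le_total t s with hts | hts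
    · refine ⟨?_, hxmono.monotoneOn ⟨ht.1, hts⟩ ⟨hs.1.le, le_rfl⟩ hts⟩
      rw [← hx1]
      exact hxmono.monotoneOn ⟨le_rfl, hs.1.le⟩ ⟨ht.1, hts⟩ ht.1
    · refine ⟨?_, hxanti.antitoneOn ⟨le_rfl, hs.2.le⟩ ⟨hts, ht.2⟩ hts⟩
      rw [← hxT]
      exact hxanti.antitoneOn ⟨hts, ht.2⟩ ⟨hs.2.le, le_rfl⟩ ht.2
  -- the geodesic through the two extreme points has centre `c` and radius `R`
  obtain ⟨c, hc⟩ : ∃ c, x s ^ 2 + y s ^ 2 - 1 - 2 * c * x s = 0 :=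
    ⟨(x s ^ 2 + y s ^ 2 - 1) / (2 * x s), by field_simp; ring⟩
  set Z : ℝ → ℝ := fun t => x t ^ 2 + y t ^ 2 - 1 - 2 * c * x t with hZdef
  have hZc : Continuous Z := by fun_prop
  have hZ0 : Z 0 = 0 := by simp [hZdef, hx1, hy1]
  have hZT : Z T = 0 := by simp [hZdef, hxT, hyT]
  have hZd : ∀ t, Real.sin (α t) ≠ 0 → HasDerivAt Z (2 * y t * Real.sin (α t) / ℓ *
      (x t - c - y t * Real.cos (α t) / Real.sin (α t))) t := by
    intro t ht
    refine (((((hx t).pow 2).add ((hy t).pow 2)).sub_const 1).sub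
      ((hx t).const_mul (2 * c))).congr_deriv ?_
    field_simp
    push_cast
    ring
  have hZ1 : ∀ t ∈ Ioo 0 s, Z t < 0 := by
    refine neg_of_deriv_eq_pos_mul_strictMono hZc.continuousOn
      (fun t ht => hZd t (hsin1 t ht).ne') (fun t ht => ?_)
      (hMmono 0 s c le_rfl hs.2.le fun t ht => (hsin1 t ht).ne') hZ0 hc
    have := hy0 t
    have := hsin1 t ht
    positivity
  have hZ2 : ∀ t ∈ Ioo s T, 0 < Z t := by
    have := neg_of_deriv_eq_pos_mul_strictMono (Z := fun t => -Z t)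
      (w := fun t => -(2 * y t * Real.sin (α t) / ℓ)) hZc.neg.continuousOn
      (fun t ht => (hZd t (hsin2 t ht).ne).neg.congr_deriv (by ring)) (fun t ht => ?_)
      (hMmono s T c hs.1.le le_rfl fun t ht => (hsin2 t ht).ne) (by simp [hZdef, hc])
      (by simp [hZT])
    · exact fun t ht => neg_lt_zero.1 (this t ht)
    · have := mul_neg_of_pos_of_neg (mul_pos two_pos (hy0 t)) (hsin2 t ht)
      exact neg_pos.2 (div_neg_of_neg_of_pos this hℓ)
  set R : ℝ := √(1 + c ^ 2) with hR
  have hR0 : 0 < R := by positivity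
  have hR2 : R ^ 2 = 1 + c ^ 2 := Real.sq_sqrt (by positivity)
  set D : ℝ → ℝ := fun t => R ^ 2 - (x t - c) ^ 2 with hD
  have hyD : ∀ t, y t ^ 2 = D t + Z t := fun t => by simp only [hD, hZdef, hR2]; ring
  have hDpos : ∀ t ∈ Icc 0 T, 0 < D t := by
    intro t ht
    obtain ⟨h1, h2⟩ := hxI t ht
    have h3 : D t * x s = (x s - x t) + y s ^ 2 * x t + x t * x s * (x s - x t) := by
      simp only [hD, hR2]
      linear_combination (-x t) * hc
    have h4 : 0 < D t * x s := by
      rw [h3]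
      have := mul_nonneg (mul_nonneg h1 hxs.le) (sub_nonneg.2 h2)
      have h5 : 0 < y s ^ 2 := pow_pos (hy0 s) 2
      rcases h1.eq_or_lt with h6 | h6
      · rw [← h6]; simpa using hxs
      · have := mul_pos h5 h6
        linarith
    exact pos_of_mul_pos_left h4 hxs.le
  have hG : ∀ t ∈ Icc 0 T, HasDerivAt (fun t => K t - α t - Real.arcsin ((x t - c) / R))
      (Real.sin (α t) / ℓ * (1 - y t / √(D t))) t := by
    intro t ht
    have hDt := hDpos t ht
    have hs1 : 1 - ((x t - c) / R) ^ 2 = D t / R ^ 2 := by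
      simp only [hD]
      field_simp
    have hlt : ((x t - c) / R) ^ 2 < 1 := by
      have : 0 < D t / R ^ 2 := by positivity
      linarith
    have hab := abs_lt.1 ((sq_lt_one_iff_abs_lt_one _).1 hlt)
    have hsq : √(1 - ((x t - c) / R) ^ 2) = √(D t) / R := by
      rw [hs1, Real.sqrt_div hDt.le, Real.sqrt_sq hR0.le]
    have hdiv : HasDerivAt (fun t => (x t - c) / R) (y t * Real.sin (α t) / ℓ / R) t :=
      ((hx t).sub_const c).div_const R
    have harc := (Real.hasDerivAt_arcsin hab.1.ne' hab.2.ne).comp t hdiv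
    refine (((hK t).sub (h t ht)).sub harc).congr_deriv ?_
    have : √(D t) ≠ 0 := (Real.sqrt_pos.2 hDt).ne'
    rw [hsq]
    field_simp
    ring
  have hGc : ContinuousOn (fun t => K t - α t - Real.arcsin ((x t - c) / R)) (Icc 0 T) :=
    fun t ht => (hG t ht).continuousAt.continuousWithinAt
  have hG1 := strictMonoOn_of_deriv_pos (convex_Icc 0 s)
    (hGc.mono (Icc_subset_Icc_right hs.2.le)) fun t ht => by
      rw [interior_Icc] at ht
      have htI : t ∈ Icc 0 T := ⟨ht.1.le, (ht.2.trans hs.2).le⟩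
      rw [(hG t htI).deriv]
      refine mul_pos (div_pos (hsin1 t ht) hℓ) (sub_pos.2 ?_)
      rw [div_lt_one (Real.sqrt_pos.2 (hDpos t htI))]
      refine Real.lt_sqrt_of_sq_lt ?_
      linarith [hyD t, hZ1 t ht]
  have hG2 := strictMonoOn_of_deriv_pos (convex_Icc s T)
    (hGc.mono (Icc_subset_Icc_left hs.1.le)) fun t ht => by
      rw [interior_Icc] at ht
      have htI : t ∈ Icc 0 T := ⟨(hs.1.trans ht.1).le, ht.2.le⟩
      rw [(hG t htI).deriv]
      refine mul_pos_of_neg_of_neg (div_neg_of_neg_of_pos (hsin2 t ht) hℓ) (sub_neg.2 ?_)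
      rw [one_lt_div (Real.sqrt_pos.2 (hDpos t htI)), Real.sqrt_lt' (hy0 t)]
      linarith [hyD t, hZ2 t ht]
  have h1 := hG1 ⟨le_rfl, hs.1.le⟩ ⟨hs.1.le, le_rfl⟩ hs.1
  have h2 := hG2 ⟨le_rfl, hs.2.le⟩ ⟨hs.2.le, le_rfl⟩ hs.2
  simp only [hα0, hx1] at h1
  simp only [hαT, hxT] at h2
  linarith

/-- A solution turning at least `3π` has total curvature more than `2π`. -/
lemma two_pi_lt_of_three_pi_le (h : IsBicycleSolution ℓ T k α) (hℓ : 0 < ℓ) (hT : 0 < T)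
    (hk : ∀ t, 0 < k t) (hαc : Continuous α) {K : ℝ → ℝ} (hK : ∀ t, HasDerivAt K (k t) t)
    (hα0 : α 0 = 0) (hαT : 3 * Real.pi ≤ α T) :
    2 * Real.pi < K T - K 0 := by
  have hpi := Real.pi_pos
  obtain ⟨t₃, ht₃, hα₃⟩ : ∃ t ∈ Icc 0 T, α t = 3 * Real.pi :=
    intermediate_value_Icc hT.le hαc.continuousOn (by rw [hα0]; exact ⟨by linarith, hαT⟩)
  obtain ⟨t₂, ht₂, hα₂⟩ : ∃ t ∈ Ioo 0 t₃, α t = 2 * Real.pi :=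
    intermediate_value_Ioo ht₃.1 hαc.continuousOn
      (by rw [hα0, hα₃]; constructor <;> linarith)
  obtain ⟨t₁, ht₁, hα₁⟩ : ∃ t ∈ Ioo 0 t₂, α t = Real.pi :=
    intermediate_value_Ioo ht₂.1.le hαc.continuousOn
      (by rw [hα0, hα₂]; constructor <;> linarith)
  have hsin3 : Real.sin (3 * Real.pi) = 0 := by exact_mod_cast Real.sin_nat_mul_pi 3
  have hKm : StrictMono K := strictMono_of_deriv_pos fun t => by rw [(hK t).deriv]; exact hk t
  have key : ∀ a b, 0 ≤ a → a < b → b ≤ T → Real.sin (α a) = 0 → Real.sin (α b) = 0 →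
      (∀ u, α a < u → u < α b → 0 ≤ Real.sin u) → α b - α a ≤ K b - K a := by
    intro a b ha hab hb hsa hsb hsin
    have hd : ∀ t ∈ Icc a b, HasDerivAt (fun t => K t - α t) (Real.sin (α t) / ℓ) t :=
      fun t ht => ((hK t).sub (h t ⟨ha.trans ht.1, ht.2.trans hb⟩)).congr_deriv (by ring)
    have hm := monotoneOn_of_deriv_nonneg (convex_Icc a b)
      (fun t ht => (hd t ht).continuousAt.continuousWithinAt)
      (fun t ht => (hd t (interior_subset ht)).differentiableAt.differentiableWithinAt)
      fun t ht => by
        rw [(hd t (interior_subset ht)).deriv]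
        rw [interior_Icc] at ht
        refine div_nonneg (hsin _ ?_ ?_) hℓ.le
        · exact h.lt_of_sin_eq_zero hk ha ht.1 (ht.2.le.trans hb) hsa
        · by_contra! hc
          obtain ⟨u, hu, hαu⟩ : ∃ u ∈ Icc a t, α u = α b :=
            intermediate_value_Icc ht.1.le hαc.continuousOn
              ⟨(h.lt_of_sin_eq_zero hk ha hab hb hsa).le, hc⟩
          exact (h.lt_of_sin_eq_zero hk (ha.trans hu.1) (hu.2.trans_lt ht.2) hb
            (by rw [hαu, hsb])).ne hαu
    have := hm ⟨le_rfl, hab.le⟩ ⟨hab.le, le_rfl⟩ hab.le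
    simp only at this
    linarith
  have k1 := key 0 t₁ le_rfl ht₁.1 (ht₁.2.le.trans (ht₂.2.le.trans ht₃.2)) (by simp [hα0])
    (by simp [hα₁]) fun u h1 h2 => by
      rw [hα0] at h1
      rw [hα₁] at h2
      exact Real.sin_nonneg_of_nonneg_of_le_pi h1.le h2.le
  have k2 := key t₂ t₃ ht₂.1.le ht₂.2 ht₃.2 (by simp [hα₂]) (by rw [hα₃, hsin3])
    fun u h1 h2 => by
      rw [hα₂] at h1
      rw [hα₃] at h2
      rw [← Real.sin_sub_two_pi]
      exact Real.sin_nonneg_of_nonneg_of_le_pi (by linarith) (by linarith)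
  have k3 := hKm ht₁.2
  have k4 := hKm.monotone ht₃.2
  rw [hα0, hα₁] at k1
  rw [hα₂, hα₃] at k2
  linarith

end IsBicycleSolution

/-- If the curvature is positive and the monodromy is trivial then the total curvature is more
than `2π`. -/
lemma two_pi_lt_integral_of_trivial_monodromy {ℓ T : ℝ} (hℓ : 0 < ℓ) (hT : 0 < T) {k : ℝ → ℝ}
    (hkc : Continuous k) (hk : ∀ t, 0 < k t)
    (hall : ∀ β, IsBicycleSolution ℓ T k β → ∃ n : ℤ, β T - β 0 = 2 * Real.pi * n) :
    2 * Real.pi < ∫ t in (0 : ℝ)..T, k t := by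
  obtain ⟨α, hαc, hα0, hα⟩ := exists_isBicycleSolution hℓ hT.le hkc
  set K : ℝ → ℝ := fun t => ∫ s in (0 : ℝ)..t, k s with hKdef
  have hK : ∀ t, HasDerivAt K (k t) t := fun t => (hkc.integral_hasStrictDerivAt 0 t).hasDerivAt
  have hK0 : K 0 = 0 := by simp [hKdef]
  suffices 2 * Real.pi < K T - K 0 by rwa [hK0, sub_zero] at this
  obtain ⟨n, hn⟩ := hall α hα
  rw [hα0, sub_zero] at hn
  have hn1 : 0 < n := by
    have h1 := hα.lt_of_sin_eq_zero hk le_rfl hT le_rfl (by simp [hα0])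
    rw [hα0, hn] at h1
    exact_mod_cast pos_of_mul_pos_right h1 Real.two_pi_pos.le
  obtain rfl | hn2 : n = 1 ∨ 2 ≤ n := by omega
  · set y : ℝ → ℝ := fun t => Real.exp (-∫ s in (0 : ℝ)..t, Real.cos (α s) / ℓ) with hydef
    have hcc : Continuous fun t => Real.cos (α t) / ℓ := by fun_prop
    have hy : ∀ t, HasDerivAt y (-(y t * Real.cos (α t) / ℓ)) t := fun t =>
      (hcc.integral_hasStrictDerivAt 0 t).hasDerivAt.neg.exp.congr_deriv
        (by simp only [hydef, Pi.neg_apply]; ring)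
    have hyc : Continuous y := continuous_iff_continuousAt.2 fun t => (hy t).continuousAt
    set x : ℝ → ℝ := fun t => ∫ s in (0 : ℝ)..t, y s * Real.sin (α s) / ℓ with hxdef
    have hsc : Continuous fun t => y t * Real.sin (α t) / ℓ := by fun_prop
    have hx : ∀ t, HasDerivAt x (y t * Real.sin (α t) / ℓ) t := fun t =>
      (hsc.integral_hasStrictDerivAt 0 t).hasDerivAt
    have hy0 : ∀ t, 0 < y t := fun t => Real.exp_pos _
    have hx1 : x 0 = 0 := by simp [hxdef]
    have hy1 : y 0 = 1 := by simp [hydef]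
    obtain ⟨hxT, hyT⟩ := hα.closed_of_trivial_monodromy hy0 hx hy hx1 hy1 hall
    exact hα.two_pi_lt_of_closed hℓ hT hk hαc hy0 hx hy hK hx1 hy1 hxT hyT hα0 (by simpa using hn)
  · refine hα.two_pi_lt_of_three_pi_le hℓ hT hk hαc hK hα0 ?_
    have : (2 : ℝ) ≤ n := by exact_mod_cast hn2
    rw [hn]
    nlinarith [Real.pi_pos]

/-- If the front track is a `C¹`-closed strictly convex curve traversed once
(curvature `k > 0`, total turning `2π`, vanishing displacement integrals), then the
bicycle monodromy is not the identity: some solution of the bicycle equation satisfies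
`α(T) − α(0) ∉ 2πℤ`. -/
theorem convex_front_track_monodromy_not_identity
    (ℓ : ℝ) (hℓ : 0 < ℓ) (T : ℝ) (hT : 0 < T)
    (k : ℝ → ℝ) (hk : ContinuousOn k (Icc 0 T))
    (hkpos : ∀ t ∈ Icc (0 : ℝ) T, 0 < k t)
    (htot : ∫ t in (0 : ℝ)..T, k t = 2 * Real.pi)
    (ψ : ℝ → ℝ) (hψ : ∀ t, ψ t = ∫ s in (0 : ℝ)..t, k s)
    (hx : ∫ t in (0 : ℝ)..T, Real.cos (ψ t) = 0)
    (hy : ∫ t in (0 : ℝ)..T, Real.sin (ψ t) = 0) :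
    ∃ α : ℝ → ℝ,
      (∀ t ∈ Icc (0 : ℝ) T, HasDerivAt α (k t - Real.sin (α t) / ℓ) t) ∧
      ¬ ∃ n : ℤ, α T - α 0 = 2 * Real.pi * n := by
  by_contra! hno
  set κ : ℝ → ℝ := IccExtend hT.le ((Icc 0 T).domRestrict k) with hκ
  have hκc : Continuous κ := hk.domRestrict.Icc_extend'
  have hκk : ∀ t ∈ Icc 0 T, κ t = k t := fun t ht => by
    rw [hκ, IccExtend_of_mem _ _ ht]; rfl
  have hκpos : ∀ t, 0 < κ t := fun t => hkpos _ (projIcc 0 T hT.le t).2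
  have hlt := two_pi_lt_integral_of_trivial_monodromy hℓ hT hκc hκpos fun β hβ =>
    hno β fun t ht => hκk t ht ▸ hβ t ht
  rw [integral_congr (g := k) fun t ht => hκk t (by rwa [uIcc_of_le hT.le] at ht), htot] at hlt
  exact lt_irrefl _ hlt
end

section
/- Let ℓ > 0, L > 0, and let α : [0,L] → ℝ be continuously differentiable with α'(t) ≥ 0 for all t, α(L) = α(0) + 2π, and ℓ·α'(t) < 1 for all t ∈ [0,L] (i.e., ℓ is smaller than the radius of the smallest osculating circle of the convex front track with tangent angle α). Then the bicycle monodromy has two distinct fixed points: there exist differentiable solutions θ₁, θ₂ : [0,L] → ℝ of the equation θ'(t) = (1/ℓ)·sin(α(t) − θ(t)) such that θ₁(L) − θ₁(0) ∈ 2πℤ, θ₂(L) − θ₂(0) ∈ 2πℤ, θ₁(0) ∈ (α(0) − π/2, α(0) + π/2), and θ₁(0) − θ₂(0) ∉ 2πℤ. -/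
open Real Set

/-- The bicycle equation has solutions through every initial direction near `x₀`, and their value
at time `L` depends continuously on the initial direction. -/
lemma exists_continuousOn_bicycle_flow {ℓ L : ℝ} (hℓ : 0 < ℓ) (hL : 0 < L) {α : ℝ → ℝ}
    (hα : Continuous α) (x₀ r : ℝ) (hr : 0 ≤ r) :
    ∃ Θ : ℝ → ℝ → ℝ,
      (∀ x ∈ Metric.closedBall x₀ r, Θ x 0 = x ∧
        ∀ t ∈ Icc (0 : ℝ) L, HasDerivAt (Θ x) (1 / ℓ * sin (α t - Θ x t)) t) ∧
      ContinuousOn (fun x ↦ Θ x L) (Metric.closedBall x₀ r) := by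
  let K : NNReal := ⟨1 / ℓ, by positivity⟩
  let R : NNReal := ⟨r, hr⟩
  let A : NNReal := ⟨r + 1 / ℓ * (L + 1), by positivity⟩
  let t₀ : Icc (-1 : ℝ) (L + 1) := ⟨0, by constructor <;> linarith⟩
  have hf : IsPicardLindelof (fun t θ ↦ 1 / ℓ * sin (α t - θ)) t₀ x₀ A R K K := by
    refine ⟨fun t _ ↦ LipschitzOnWith.of_dist_le_mul fun x _ y _ ↦ ?_, fun x _ ↦ ?_,
      fun t _ x _ ↦ ?_, ?_⟩
    · have h := (LipschitzWith.of_dist_le_mul (K := 1) fun a b ↦ by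
        simpa [Real.dist_eq] using abs_sin_sub_sin_le a b : LipschitzWith 1 sin).dist_le_mul
          (α t - x) (α t - y)
      rw [NNReal.coe_one, one_mul, dist_sub_left] at h
      rw [Real.dist_eq, ← mul_sub, abs_mul, abs_of_pos (by positivity), ← Real.dist_eq]
      exact mul_le_mul_of_nonneg_left h (by positivity)
    · fun_prop
    · rw [norm_mul, Real.norm_of_nonneg (by positivity : 0 ≤ 1 / ℓ)]
      exact mul_le_of_le_one_right (by positivity) (abs_sin_le_one _)
    · change 1 / ℓ * max (L + 1 - 0) (0 - -1) ≤ r + 1 / ℓ * (L + 1) - r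
      rw [max_eq_left (by linarith)]
      linarith
  obtain ⟨Θ, hΘ, M, hM⟩ :=
    hf.exists_forall_mem_closedBall_eq_hasDerivWithinAt_lipschitzOnWith
  refine ⟨Θ, fun x hx ↦ ⟨(hΘ x hx).1, fun t ht ↦ ?_⟩, (hM L ⟨by linarith, by linarith⟩).continuousOn⟩
  exact ((hΘ x hx).2 t ⟨by linarith [ht.1], by linarith [ht.2]⟩).hasDerivAt
    (Icc_mem_nhds (by linarith [ht.1]) (by linarith [ht.2]))

/-- A function whose derivative is negative wherever it takes the value `r` stays below `r`. -/
lemma le_of_hasDerivAt_of_deriv_neg {L r : ℝ} {φ φ' : ℝ → ℝ}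
    (hφ : ∀ t ∈ Icc (0 : ℝ) L, HasDerivAt φ (φ' t) t) (h₀ : φ 0 ≤ r)
    (hneg : ∀ t ∈ Icc (0 : ℝ) L, φ t = r → φ' t < 0) {t : ℝ} (ht : t ∈ Icc 0 L) : φ t ≤ r :=
  image_le_of_deriv_right_lt_deriv_boundary (B := fun _ ↦ r) (B' := fun _ ↦ 0)
    (fun s hs ↦ (hφ s hs).continuousAt.continuousWithinAt)
    (fun s hs ↦ (hφ s (Ico_subset_Icc_self hs)).hasDerivWithinAt) h₀
    (fun s ↦ hasDerivAt_const s r) (fun s hs ↦ hneg s (Ico_subset_Icc_self hs)) ht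

/-- If the curvature of the front track is smaller than `1 / ℓ` in absolute value, then some
bicycle motion starts in the open half-circle around the tangent direction and makes the same angle
with the front track at both ends. -/
lemma exists_bicycle_solution_same_steering_angle {ℓ L : ℝ} (hℓ : 0 < ℓ) (hL : 0 < L)
    {α α' : ℝ → ℝ} (hα : ∀ t, HasDerivAt α (α' t) t) (hα' : Continuous α')
    (hosc : ∀ t ∈ Icc (0 : ℝ) L, ℓ * |α' t| < 1) :
    ∃ θ : ℝ → ℝ,
      (∀ t ∈ Icc (0 : ℝ) L, HasDerivAt θ (1 / ℓ * sin (α t - θ t)) t) ∧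
      α L - θ L = α 0 - θ 0 ∧ α 0 - θ 0 ∈ Ioo (-(π / 2)) (π / 2) := by
  obtain ⟨s, hs, hmax⟩ := isCompact_Icc.exists_isMaxOn (nonempty_Icc.2 hL.le)
    (continuous_const.mul hα'.abs : Continuous fun t ↦ ℓ * |α' t|).continuousOn
  obtain ⟨c, hsc, hc₁⟩ := exists_between (hosc s hs)
  have hbound : ∀ t ∈ Icc (0 : ℝ) L, |α' t| < 1 / ℓ * c := fun t ht ↦ by
    rw [one_div_mul_eq_div, lt_div_iff₀' hℓ]
    exact (hmax ht).trans_lt hsc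
  have hc₀ : 0 < c := lt_of_le_of_lt (by positivity) hsc
  have hr₀ : 0 ≤ arcsin c := arcsin_nonneg.2 hc₀.le
  have hsin : sin (arcsin c) = c := sin_arcsin (by linarith) hc₁.le
  obtain ⟨Θ, hΘ, hcont⟩ := exists_continuousOn_bicycle_flow hℓ hL
    (continuous_iff_continuousAt.2 fun t ↦ (hα t).continuousAt) (α 0) (arcsin c) hr₀
  rw [closedBall_eq_Icc] at hΘ hcont
  have hmaps : MapsTo (fun x ↦ Θ x L - (α L - α 0)) (Icc (α 0 - arcsin c) (α 0 + arcsin c))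
      (Icc (α 0 - arcsin c) (α 0 + arcsin c)) := by
    intro x hx
    obtain ⟨hx₀, hxd⟩ := hΘ x hx
    have upper : α L - Θ x L ≤ arcsin c :=
      le_of_hasDerivAt_of_deriv_neg (fun t ht ↦ (hα t).sub (hxd t ht))
        (by simp only [Pi.sub_apply]; linarith [hx.1])
        (fun t ht h ↦ by
          simp only [Pi.sub_apply] at h
          rw [h, hsin]
          linarith [(abs_lt.1 (hbound t ht)).2]) (right_mem_Icc.2 hL.le)
    have lower : Θ x L - α L ≤ arcsin c :=
      le_of_hasDerivAt_of_deriv_neg (fun t ht ↦ (hxd t ht).sub (hα t))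
        (by simp only [Pi.sub_apply]; linarith [hx.2])
        (fun t ht h ↦ by
          simp only [Pi.sub_apply] at h
          rw [← neg_sub (Θ x t) (α t), h, sin_neg, hsin]
          linarith [(abs_lt.1 (hbound t ht)).1]) (right_mem_Icc.2 hL.le)
    constructor <;> linarith
  obtain ⟨x, hx, hfix⟩ := exists_mem_Icc_isFixedPt_of_mapsTo
    (hcont.sub continuousOn_const) (by linarith) hmaps
  have hfix' : Θ x L - (α L - α 0) = x := hfix
  have hlt : arcsin c < π / 2 := arcsin_lt_pi_div_two.2 hc₁
  obtain ⟨hx₀, hxd⟩ := hΘ x hx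
  refine ⟨Θ x, hxd, by linarith, ?_⟩
  rw [hx₀]
  constructor <;> linarith [hx.1, hx.2]

/-- If the bicycle length `ℓ` is smaller than the radius of the smallest osculating
circle of a convex front track (with tangent angle `α`, `α' ≥ 0`, total turning `2π`),
then the bicycle monodromy is hyperbolic: it has two distinct fixed points, one of them
with initial frame direction in `(α(0) − π/2, α(0) + π/2)`. -/
theorem small_bicycle_hyperbolic_monodromy
    (ℓ : ℝ) (hℓ : 0 < ℓ) (L : ℝ) (hL : 0 < L)
    (α α' : ℝ → ℝ)
    (hα : ∀ t, HasDerivAt α (α' t) t) (hα' : Continuous α')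
    (hmono : ∀ t ∈ Icc (0 : ℝ) L, 0 ≤ α' t)
    (hclosed : α L = α 0 + 2 * Real.pi)
    (hosc : ∀ t ∈ Icc (0 : ℝ) L, ℓ * α' t < 1) :
    ∃ θ₁ θ₂ : ℝ → ℝ,
      (∀ t ∈ Icc (0 : ℝ) L,
        HasDerivAt θ₁ ((1 / ℓ) * Real.sin (α t - θ₁ t)) t) ∧
      (∀ t ∈ Icc (0 : ℝ) L,
        HasDerivAt θ₂ ((1 / ℓ) * Real.sin (α t - θ₂ t)) t) ∧
      (∃ n : ℤ, θ₁ L - θ₁ 0 = 2 * Real.pi * n) ∧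
      (∃ n : ℤ, θ₂ L - θ₂ 0 = 2 * Real.pi * n) ∧
      θ₁ 0 ∈ Ioo (α 0 - Real.pi / 2) (α 0 + Real.pi / 2) ∧
      ¬ ∃ n : ℤ, θ₁ 0 - θ₂ 0 = 2 * Real.pi * n := by
  have habs : ∀ t ∈ Icc (0 : ℝ) L, ℓ * |α' t| < 1 := fun t ht ↦ by
    rw [abs_of_nonneg (hmono t ht)]
    exact hosc t ht
  have hsub : ∀ t : ℝ, HasDerivAt (fun s ↦ L - s) (-1) t := fun t ↦ by
    simpa using (hasDerivAt_id t).const_sub L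
  have hrefl : ∀ t ∈ Icc (0 : ℝ) L, L - t ∈ Icc 0 L := fun t ht ↦
    ⟨by linarith [ht.2], by linarith [ht.1]⟩
  obtain ⟨θ, hθ, hfix, hmem⟩ :=
    exists_bicycle_solution_same_steering_angle hℓ hL hα hα' habs
  -- The second motion comes from the track traversed backwards.
  obtain ⟨η, hη, hfix', hmem'⟩ :=
    exists_bicycle_solution_same_steering_angle (α := fun t ↦ α (L - t))
      (α' := fun t ↦ α' (L - t) * -1) hℓ hL (fun t ↦ (hα (L - t)).comp t (hsub t))
      (by fun_prop) (fun t ht ↦ by simpa using habs _ (hrefl t ht))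
  simp only [sub_self, sub_zero] at hfix' hmem'
  refine ⟨θ, fun t ↦ η (L - t) + π, hθ, fun t ht ↦ ?_, ⟨1, ?_⟩, ⟨1, ?_⟩, ?_, ?_⟩
  · refine (((hη _ (hrefl t ht)).comp t (hsub t)).add_const π).congr_deriv ?_
    rw [sub_sub_cancel, ← sub_sub, sin_sub_pi]
    ring
  · push_cast
    linarith
  · simp only [sub_self, sub_zero]
    push_cast
    linarith
  · constructor <;> linarith [hmem.1, hmem.2]
  · rintro ⟨n, hn⟩
    simp only [sub_zero] at hn
    have h₀ : -1 < (n : ℝ) := by nlinarith [hmem.1, hmem.2, hmem'.1, hmem'.2, pi_pos]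
    have h₁ : (n : ℝ) < 0 := by nlinarith [hmem.1, hmem.2, hmem'.1, hmem'.2, pi_pos]
    norm_cast at h₀ h₁
    lia
end

section
/- (Menzin's conjecture for convex curves.) Let ℓ > 0 and let F : ℝ → ℝ² be a twice continuously differentiable T-periodic curve with ‖F'(t)‖ = 1 for all t, injective on [0,T), positively oriented, and strictly convex, i.e., its curvature k(t) = F₁'(t)·F₂''(t) − F₂'(t)·F₁''(t) satisfies k(t) > 0 for all t. Let A = (1/2)·∫₀ᵀ (F₁(t)·F₂'(t) − F₂(t)·F₁'(t)) dt be the area enclosed by F, and assume A > π·ℓ². Then the bicycle monodromy is hyperbolic with an attracting fixed point: there exist differentiable solutions α₁, α₂ : ℝ → ℝ of the bicycle equation α'(t) = k(t) − sin(α(t))/ℓ such that αᵢ(t + T) − αᵢ(t) ∈ 2πℤ for all t and i = 1, 2, α₁(0) − α₂(0) ∉ 2πℤ, and ∫₀ᵀ cos(α₁(t)) dt > 0 > ∫₀ᵀ cos(α₂(t)) dt. -/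
open Real Set intervalIntegral

/-- `α` is a steering angle along a front track of curvature `k`, the bicycle having inverse
length `c`. -/
def IsSteering (k : ℝ → ℝ) (c : ℝ) (α : ℝ → ℝ) : Prop :=
  ∀ t, HasDerivAt α (k t - c * Real.sin (α t)) t

lemma lipschitzWith_steering (k : ℝ → ℝ) (c t : ℝ) :
    LipschitzWith (Real.nnabs c) fun x => k t - c * Real.sin x := by
  refine LipschitzWith.of_dist_le_mul fun x y => ?_
  have h := Real.abs_sin_sub_sin_le x y
  rw [Real.dist_eq, Real.dist_eq, Real.coe_nnabs,
    show k t - c * Real.sin x - (k t - c * Real.sin y) = -(c * (Real.sin x - Real.sin y)) by ring,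
    abs_neg, abs_mul]
  gcongr

lemma IsSteering.eq_of_eq {k : ℝ → ℝ} {c t₀ : ℝ} {α β : ℝ → ℝ}
    (hα : IsSteering k c α) (hβ : IsSteering k c β) (h : α t₀ = β t₀) : α = β :=
  ODE_solution_unique_univ (v := fun t x => k t - c * Real.sin x) (s := fun _ => univ)
    (fun t => (lipschitzWith_steering k c t).lipschitzOnWith)
    (fun t => ⟨hα t, mem_univ _⟩) (fun t => ⟨hβ t, mem_univ _⟩) h

lemma exists_steering_on {k : ℝ → ℝ} (hk : Continuous k) (c a : ℝ) {N : ℝ} (hN : 0 < N) :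
    ∃ α : ℝ → ℝ, α 0 = a ∧
      ∀ t ∈ Ioo (-N) N, HasDerivAt α (k t - c * Real.sin (α t)) t := by
  obtain ⟨C, hC⟩ := isCompact_Icc.exists_bound_of_continuousOn (s := Icc (-N) N) hk.continuousOn
  have h0 : (0 : ℝ) ∈ Icc (-N) N := ⟨by linarith, hN.le⟩
  have hC0 : 0 ≤ C := (norm_nonneg _).trans (hC 0 h0)
  have hpl : IsPicardLindelof (fun t x => k t - c * Real.sin x) (⟨0, h0⟩ : Icc (-N) N) a
      (⟨(C + |c|) * N, by positivity⟩) 0 (⟨C + |c|, by positivity⟩) (Real.nnabs c) := by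
    refine ⟨fun t _ => (lipschitzWith_steering k c t).lipschitzOnWith,
      fun x _ => (hk.sub continuous_const).continuousOn, fun t ht x _ => ?_, ?_⟩
    · refine (norm_sub_le _ _).trans (add_le_add (hC t ht) ?_)
      rw [Real.norm_eq_abs, abs_mul]
      exact mul_le_of_le_one_right (abs_nonneg _) (Real.abs_sin_le_one x)
    · change (C + |c|) * max (N - 0) (0 - -N) ≤ (C + |c|) * N - 0
      simp
  obtain ⟨α, h1, h2⟩ := hpl.exists_eq_forall_mem_Icc_hasDerivWithinAt₀
  exact ⟨α, h1, fun t ht => (h2 t (Ioo_subset_Icc_self ht)).hasDerivAt (Icc_mem_nhds ht.1 ht.2)⟩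

lemma exists_steering {k : ℝ → ℝ} (hk : Continuous k) (c a : ℝ) :
    ∃ α, α 0 = a ∧ IsSteering k c α := by
  choose s hs0 hs using fun n : ℕ => exists_steering_on hk c a (N := n + 1) (by positivity)
  have key : ∀ m n : ℕ, m ≤ n → EqOn (s m) (s n) (Ioo (-(m + 1 : ℝ)) (m + 1)) := by
    intro m n hmn
    have hmn' : (m : ℝ) ≤ n := by exact_mod_cast hmn
    have hm0 : (0 : ℝ) ≤ m := by positivity
    refine ODE_solution_unique_of_mem_Ioo (v := fun t x => k t - c * Real.sin x)
      (s := fun _ => univ) (t₀ := 0)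
      (fun t _ => (lipschitzWith_steering k c t).lipschitzOnWith) ⟨by linarith, by linarith⟩
      (fun t ht => ⟨hs m t ht, mem_univ _⟩)
      (fun t ht => ⟨hs n t ⟨by linarith [ht.1], by linarith [ht.2]⟩, mem_univ _⟩) ?_
    rw [hs0, hs0]
  have key' : ∀ (m n : ℕ) (t : ℝ), |t| < m + 1 → |t| < n + 1 → s m t = s n t := by
    intro m n t hm hn
    rcases le_total m n with h | h
    · exact key m n h (abs_lt.1 hm)
    · exact (key n m h (abs_lt.1 hn)).symm
  refine ⟨fun t => s ⌈|t|⌉₊ t, by simp [hs0], fun t => ?_⟩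
  obtain ⟨n, hn⟩ := exists_nat_gt |t|
  have hev : (fun t => s ⌈|t|⌉₊ t) =ᶠ[nhds t] s n := by
    filter_upwards [(isOpen_lt continuous_abs continuous_const).mem_nhds hn] with u hu
    exact key' _ _ _ (by linarith [Nat.le_ceil |u|]) (by linarith [show |u| < n from hu])
  have h := hs n t (abs_lt.1 (by linarith))
  rw [← hev.self_of_nhds] at h
  exact h.congr_of_eventuallyEq hev

lemma IsSteering.continuous {k : ℝ → ℝ} {c : ℝ} {α : ℝ → ℝ} (hα : IsSteering k c α) :
    Continuous α :=
  continuous_iff_continuousAt.2 fun t => (hα t).continuousAt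

lemma IsSteering.shift {k : ℝ → ℝ} {c T : ℝ} {α : ℝ → ℝ} (hα : IsSteering k c α)
    (hkT : Function.Periodic k T) : IsSteering k c fun t => α (t + T) := fun t => by
  simpa [hkT t] using (hα (t + T)).comp_add_const t T

lemma IsSteering.add_two_pi {k : ℝ → ℝ} {c : ℝ} {α : ℝ → ℝ} (hα : IsSteering k c α) (n : ℤ) :
    IsSteering k c fun t => α t + n * (2 * π) := fun t => by
  simpa [Real.sin_add_int_mul_two_pi] using (hα t).add_const (n * (2 * π))

/-- Continuous dependence on the initial angle and the inverse length. -/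
lemma IsSteering.abs_sub_le {k : ℝ → ℝ} {c c' T : ℝ} {α β : ℝ → ℝ}
    (hα : IsSteering k c α) (hβ : IsSteering k c' β) :
    ∀ t ∈ Icc 0 T, |α t - β t| ≤ gronwallBound |α 0 - β 0| |c| |c - c'| t := by
  intro t ht
  have := dist_le_of_approx_trajectories_ODE (v := fun t x => k t - c * Real.sin x)
    (K := Real.nnabs c) (f := α) (g := β) (a := 0) (b := T) (εf := 0) (εg := |c - c'|)
    (lipschitzWith_steering k c) hα.continuous.continuousOn
    (fun t _ => (hα t).hasDerivWithinAt) (fun t _ => by simp) hβ.continuous.continuousOn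
    (fun t _ => (hβ t).hasDerivWithinAt) (fun t _ => ?_) (δ := |α 0 - β 0|)
    (by rw [Real.dist_eq]) t ht
  · simpa [Real.dist_eq] using this
  · rw [Real.dist_eq, show k t - c' * Real.sin (β t) - (k t - c * Real.sin (β t)) =
      (c - c') * Real.sin (β t) by ring, abs_mul]
    exact mul_le_of_le_one_right (abs_nonneg _) (Real.abs_sin_le_one _)

/-- Half the difference of two steering angles. -/
lemma IsSteering.sin_half_sub {k : ℝ → ℝ} {c : ℝ} {α β : ℝ → ℝ}
    (hα : IsSteering k c α) (hβ : IsSteering k c β) (t : ℝ) :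
    Real.sin ((α t - β t) / 2) = Real.sin ((α 0 - β 0) / 2) *
      Real.exp (-(c / 2 * ∫ s in (0 : ℝ)..t, (Real.cos (α s) + Real.cos (β s)))) := by
  have hcont : Continuous fun s => Real.cos (α s) + Real.cos (β s) :=
    (Real.continuous_cos.comp hα.continuous).add (Real.continuous_cos.comp hβ.continuous)
  set I : ℝ → ℝ := fun t => ∫ s in (0 : ℝ)..t, (Real.cos (α s) + Real.cos (β s)) with hI
  have hId : ∀ t, HasDerivAt I (Real.cos (α t) + Real.cos (β t)) t :=
    fun t => hcont.integral_hasStrictDerivAt 0 t |>.hasDerivAt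
  have hd : ∀ t, HasDerivAt (fun t => Real.sin ((α t - β t) / 2) * Real.exp (c / 2 * I t)) 0 t := by
    intro t
    have h1 := (((hα t).sub (hβ t)).div_const 2).sin
    have h2 := ((hId t).const_mul (c / 2)).exp
    refine (h1.mul h2).congr_deriv ?_
    obtain ⟨s, d, hs, hd⟩ : ∃ s d, α t = s + d ∧ β t = s - d :=
      ⟨(α t + β t) / 2, (α t - β t) / 2, by ring, by ring⟩
    simp only [Pi.sub_apply]
    rw [hs, hd, show (s + d - (s - d)) / 2 = d by ring, Real.sin_add, Real.sin_sub, Real.cos_add,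
      Real.cos_sub]
    ring
  have hc := is_const_of_deriv_eq_zero (fun t => (hd t).differentiableAt)
    (fun t => (hd t).deriv) t 0
  have hI0 : I 0 = 0 := by simp [hI]
  simp only [hI0, mul_zero, Real.exp_zero, mul_one] at hc
  rw [← hc, mul_assoc, ← Real.exp_add]
  simp [hI]

lemma lt_of_deriv_pos_of_eq {f f' : ℝ → ℝ} {b : ℝ} (hf : ∀ t, HasDerivAt f (f' t) t)
    (hpos : ∀ t, f t = b → 0 < f' t) {s t : ℝ} (hst : s < t) (hs : b ≤ f s) : b < f t := by
  have hle : ∀ u ∈ Icc s t, b ≤ f u := fun u hu =>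
    image_le_of_deriv_right_lt_deriv_boundary' (f := fun _ => b) (f' := fun _ => 0) (B := f)
      (B' := f') (a := s) (b := t) continuousOn_const (fun x _ => hasDerivWithinAt_const _ _ _)
      hs (fun x _ => (hf x).continuousAt.continuousWithinAt) (fun x _ => (hf x).hasDerivWithinAt)
      (fun x _ hx => hpos x hx.symm) hu
  refine lt_of_le_of_ne (hle t ⟨hst.le, le_rfl⟩) fun heq => ?_
  have h1 := (hasDerivAt_iff_tendsto_slope.1 (hf t)).mono_left
    (nhdsWithin_mono t (show Iio t ⊆ {t}ᶜ from fun x hx => ne_of_lt hx))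
  have h2 := hpos t heq.symm
  obtain ⟨u, hu1, hu2⟩ := ((h1.eventually (lt_mem_nhds h2)).and
    (Ioo_mem_nhdsLT hst)).exists
  rw [slope_def_field] at hu1
  have h3 := hle u ⟨hu2.1.le, hu2.2.le⟩
  have : (f u - f t) / (u - t) ≤ 0 :=
    div_nonpos_of_nonneg_of_nonpos (by linarith) (by linarith [hu2.2])
  linarith

lemma IsSteering.int_mul_pi_lt {k : ℝ → ℝ} {c : ℝ} {α : ℝ → ℝ} (hα : IsSteering k c α)
    (hk : ∀ t, 0 < k t) (n : ℤ) {s t : ℝ} (hst : s < t) (hs : n * π ≤ α s) : n * π < α t :=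
  lt_of_deriv_pos_of_eq hα (fun t ht => by rw [ht, Real.sin_int_mul_pi]; simpa using hk t) hst hs

/-- A closed steering angle starting in `[0, 2π]` stays in `(0, π)`. -/
lemma IsSteering.mem_Ioo_of_periodic {k : ℝ → ℝ} {c T : ℝ} {α : ℝ → ℝ} (hα : IsSteering k c α)
    (hk : ∀ t, 0 < k t) (hc : 0 < c) (hT : 0 < T) (hper : Function.Periodic α T)
    (h0 : α 0 ∈ Icc 0 (2 * π)) (t : ℝ) : α t ∈ Ioo 0 π := by
  have hmul : ∀ n : ℤ, ∀ s t, n * π ≤ α s → n * π < α t := by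
    intro n s t hs
    obtain ⟨m, hm⟩ := exists_nat_gt ((s - t) / T)
    have : s < t + m * T := by
      rw [div_lt_iff₀ hT] at hm; linarith
    have h := hα.int_mul_pi_lt hk n this hs
    rwa [hper.nat_mul m] at h
  have hpos : ∀ t, 0 < α t := fun t => by simpa using hmul 0 0 t (by simpa using h0.1)
  have hlt : ∀ t, α t < 2 * π := fun t => by
    by_contra! h
    have := hmul 2 t 0 (by push_cast; linarith)
    push_cast at this
    linarith [h0.2]
  refine ⟨hpos t, ?_⟩
  by_contra! h
  have hgt : ∀ s, π < α s := fun s => by simpa using hmul 1 t s (by simpa using h)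
  have hmono : StrictMono α := strictMono_of_hasDerivAt_pos hα fun s => by
    have : Real.sin (α s) < 0 := by
      have := Real.sin_pos_of_pos_of_lt_pi (x := α s - π) (by linarith [hgt s])
        (by linarith [hlt s])
      rw [Real.sin_sub_pi] at this
      linarith
    nlinarith [hk s]
  have := hmono hT
  rw [← hper 0, zero_add] at this
  exact lt_irrefl _ this

lemma continuousAt_sq_mul_cos_div_sin {f : ℝ → ℝ} {f' c z : ℝ} (hf : HasDerivAt f f' z)
    (hfz : f z = 0) (hz : Real.sin (z - c) = 0) :
    ContinuousAt (fun x => f x ^ 2 * Real.cos (x - c) / Real.sin (x - c)) z := by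
  have hcos : Real.cos (z - c) ≠ 0 := fun h => by
    have := Real.sin_sq_add_cos_sq (z - c)
    rw [h, hz] at this
    norm_num at this
  have hg : HasDerivAt (fun x => Real.sin (x - c)) (Real.cos (z - c)) z := by
    simpa using ((hasDerivAt_id z).sub_const c).sin
  have h1 := (hasDerivAt_iff_tendsto_slope.1 hf).div (hasDerivAt_iff_tendsto_slope.1 hg) hcos
  have h2 : Filter.Tendsto (fun x => f x * Real.cos (x - c)) (nhdsWithin z {z}ᶜ)
      (nhds (f z * Real.cos (z - c))) :=
    ((hf.continuousAt.mul (by fun_prop)).tendsto).mono_left nhdsWithin_le_nhds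
  have h3 := h2.mul h1
  rw [hfz, zero_mul, zero_mul] at h3
  rw [continuousAt_iff_punctured_nhds, hfz]
  simp only [ne_eq, OfNat.ofNat_ne_zero, not_false_eq_true, zero_pow, zero_mul, zero_div]
  refine h3.congr' ?_
  filter_upwards [self_mem_nhdsWithin] with x hx
  have hx' : x - z ≠ 0 := sub_ne_zero.2 hx
  rw [Pi.div_apply, slope_def_field, slope_def_field, hfz, hz, sub_zero, sub_zero,
    div_div_div_cancel_right₀ hx']
  ring

/-- Wirtinger's inequality for functions vanishing at both ends of an interval of length `π`. -/
lemma integral_sq_sub_deriv_sq_nonpos_of_eq_zero {f f' : ℝ → ℝ}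
    (hf : ∀ x, HasDerivAt f (f' x) x) (hf' : Continuous f') {c : ℝ} (h0 : f c = 0)
    (h1 : f (c + π) = 0) : ∫ x in c..(c + π), (f x ^ 2 - f' x ^ 2) ≤ 0 := by
  have hfc : Continuous f := continuous_iff_continuousAt.2 fun t => (hf t).continuousAt
  have hcont : Continuous fun x => f x ^ 2 - f' x ^ 2 := by fun_prop
  set G : ℝ → ℝ := fun x => f x ^ 2 * Real.cos (x - c) / Real.sin (x - c) with hG
  set H : ℝ → ℝ := fun x => (∫ u in c..x, (f u ^ 2 - f' u ^ 2)) + G x with hH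
  have hI : ∀ x, HasDerivAt (fun x => ∫ u in c..x, (f u ^ 2 - f' u ^ 2)) (f x ^ 2 - f' x ^ 2) x :=
    fun x => (hcont.integral_hasStrictDerivAt c x).hasDerivAt
  have hsin : ∀ x ∈ Ioo c (c + π), 0 < Real.sin (x - c) := fun x hx =>
    Real.sin_pos_of_pos_of_lt_pi (by linarith [hx.1]) (by linarith [hx.2])
  have hGd : ∀ x ∈ Ioo c (c + π), HasDerivAt G
      (f' x ^ 2 - f x ^ 2 - (f' x - f x * Real.cos (x - c) / Real.sin (x - c)) ^ 2) x := by
    intro x hx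
    have hs := (hsin x hx).ne'
    have hid := (hasDerivAt_id x).sub_const c
    refine ((((hf x).pow 2).mul hid.cos).div hid.sin hs).congr_deriv ?_
    simp only [Pi.mul_apply, Pi.pow_apply, id]
    field_simp
    push_cast
    ring
  have hHc : ContinuousOn H (Icc c (c + π)) := by
    refine ContinuousOn.add (fun x _ => (hI x).continuousAt.continuousWithinAt) fun x hx => ?_
    apply ContinuousAt.continuousWithinAt
    rcases eq_or_lt_of_le hx.1 with rfl | hx1
    · exact continuousAt_sq_mul_cos_div_sin (hf _) h0 (by simp)
    rcases eq_or_lt_of_le hx.2 with rfl | hx2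
    · exact continuousAt_sq_mul_cos_div_sin (hf _) h1 (by simp)
    · exact (hGd x ⟨hx1, hx2⟩).continuousAt
  have hanti : AntitoneOn H (Icc c (c + π)) := by
    refine antitoneOn_of_hasDerivWithinAt_nonpos (convex_Icc _ _) hHc
      (f' := fun x => -(f' x - f x * Real.cos (x - c) / Real.sin (x - c)) ^ 2)
      (fun x hx => ?_) fun x _ => by simpa using sq_nonneg _
    rw [interior_Icc] at hx
    refine (((hI x).add (hGd x hx)).congr_deriv ?_).hasDerivWithinAt
    ring
  have := hanti (left_mem_Icc.2 (by linarith [pi_pos])) (right_mem_Icc.2 (by linarith [pi_pos]))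
    (by linarith [pi_pos])
  simpa [hH, hG, h0, h1] using this

/-- Wirtinger's inequality for periodic functions of mean zero. -/
lemma integral_sq_sub_deriv_sq_nonpos {p p' : ℝ → ℝ} (hp : ∀ x, HasDerivAt p (p' x) x)
    (hp' : Continuous p') (hper : Function.Periodic p (2 * π)) {x₀ : ℝ}
    (hmean : ∫ x in x₀..(x₀ + 2 * π), p x = 0) :
    ∫ x in x₀..(x₀ + 2 * π), (p x ^ 2 - p' x ^ 2) ≤ 0 := by
  have hpc : Continuous p := continuous_iff_continuousAt.2 fun t => (hp t).continuousAt
  have hper' : Function.Periodic p' (2 * π) := fun x => by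
    have h := (hp (x + 2 * π)).comp_add_const x (2 * π)
    rw [show (fun x => p (x + 2 * π)) = p from funext hper] at h
    exact h.unique (hp x)
  obtain ⟨c, hc⟩ : ∃ c, p (c + π) - p c = 0 := by
    have hcont : Continuous fun c => p (c + π) - p c := by fun_prop
    have h2 : p (0 + π + π) = p 0 := by rw [← hper 0]; congr 1; ring
    rcases le_total 0 (p (0 + π) - p 0) with h | h
    · exact mem_range_of_exists_le_of_exists_ge hcont ⟨0 + π, by linarith⟩ ⟨0, h⟩
    · exact mem_range_of_exists_le_of_exists_ge hcont ⟨0, h⟩ ⟨0 + π, by linarith⟩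
  have hshift : ∀ {g : ℝ → ℝ}, Function.Periodic g (2 * π) →
      ∫ x in x₀..(x₀ + 2 * π), g x = ∫ x in c..(c + 2 * π), g x :=
    fun hg => hg.intervalIntegral_add_eq x₀ c
  rw [hshift hper] at hmean
  rw [hshift (fun x => by simp only [hper x, hper' x])]
  set a := p c with ha
  have hd : ∀ x, HasDerivAt (fun x => p x - a) (p' x) x := fun x => (hp x).sub_const a
  have hI1 := integral_sq_sub_deriv_sq_nonpos_of_eq_zero hd hp' (c := c) (by simp [ha])
    (by linarith)
  have hI2 := integral_sq_sub_deriv_sq_nonpos_of_eq_zero hd hp' (c := c + π) (by linarith)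
    (by rw [show c + π + π = c + 2 * π by ring, hper]; simp [ha])
  have hcont : Continuous fun x => (p x - a) ^ 2 - p' x ^ 2 := by fun_prop
  have hsum := integral_add_adjacent_intervals (hcont.intervalIntegrable (μ := MeasureTheory.volume)
    c (c + π)) (hcont.intervalIntegrable (c + π) (c + π + π))
  rw [show c + π + π = c + 2 * π by ring] at hsum hI2
  have hcontp : Continuous fun x => p x ^ 2 - p' x ^ 2 := by fun_prop
  have hexp : ∫ x in c..(c + 2 * π), ((p x - a) ^ 2 - p' x ^ 2) =
      (∫ x in c..(c + 2 * π), (p x ^ 2 - p' x ^ 2)) - 2 * a * (∫ x in c..(c + 2 * π), p x)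
        + 2 * π * a ^ 2 := by
    have : ∀ x, (p x - a) ^ 2 - p' x ^ 2 = (p x ^ 2 - p' x ^ 2) - 2 * a * p x + a ^ 2 :=
      fun x => by ring
    simp_rw [this]
    rw [integral_add (Continuous.intervalIntegrable (by fun_prop) _ _) (by simp),
      integral_sub (hcontp.intervalIntegrable _ _) (Continuous.intervalIntegrable (by fun_prop) _ _),
      integral_const_mul, integral_const]
    simp
  rw [hmean] at hexp
  nlinarith [mul_nonneg pi_pos.le (sq_nonneg a)]

/-- Wirtinger's inequality along a reparametrization `θ` of the circle. -/
lemma integral_sq_sub_sq_mul_deriv_nonpos {q m θ θ' : ℝ → ℝ} {T : ℝ}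
    (hθ : ∀ t, HasDerivAt θ (θ' t) t) (hθ' : Continuous θ') (hpos : ∀ t, 0 < θ' t)
    (hθT : ∀ t, θ (t + T) = θ t + 2 * π) (hq : ∀ t, HasDerivAt q (m t * θ' t) t)
    (hm : Continuous m) (hqT : Function.Periodic q T)
    (hmean : ∫ t in (0 : ℝ)..T, q t * θ' t = 0) :
    ∫ t in (0 : ℝ)..T, (q t ^ 2 - m t ^ 2) * θ' t ≤ 0 := by
  have hθc : Continuous θ := continuous_iff_continuousAt.2 fun t => (hθ t).continuousAt
  have hqc : Continuous q := continuous_iff_continuousAt.2 fun t => (hq t).continuousAt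
  have hmono : StrictMono θ := strictMono_of_hasDerivAt_pos hθ hpos
  have hmulT : ∀ (n : ℕ) t, θ (t + n * T) = θ t + n * (2 * π) := by
    intro n
    induction n with
    | zero => simp
    | succ n ih =>
      intro t
      rw [show t + ((n + 1 : ℕ) : ℝ) * T = t + n * T + T by push_cast; ring, hθT, ih]
      push_cast; ring
  have hsurj : Function.Surjective θ := by
    intro y
    obtain ⟨n, hn⟩ := exists_nat_gt (|y - θ 0| / (2 * π))
    rw [div_lt_iff₀ (by positivity), abs_lt] at hn
    refine mem_range_of_exists_le_of_exists_ge hθc ⟨0 - n * T, ?_⟩ ⟨0 + n * T, ?_⟩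
    · have := hmulT n (0 - n * T)
      rw [sub_add_cancel] at this
      linarith
    · rw [hmulT]; linarith
  let e := hmono.orderIsoOfSurjective θ hsurj
  have he : ∀ t, e.symm (θ t) = t := fun t => e.symm_apply_apply t
  have he' : ∀ x, θ (e.symm x) = x := fun x => e.apply_symm_apply x
  have hec : Continuous e.symm := e.symm.continuous
  have hp : ∀ x, HasDerivAt (fun x => q (e.symm x)) (m (e.symm x)) x := by
    intro x
    have h1 : HasDerivAt e.symm (θ' (e.symm x))⁻¹ x :=
      (hθ (e.symm x)).of_local_left_inverse hec.continuousAt (hpos _).ne'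
        (Filter.Eventually.of_forall he')
    refine ((hq (e.symm x)).comp x h1).congr_deriv ?_
    rw [mul_assoc, mul_inv_cancel₀ (hpos _).ne', mul_one]
  have hperp : Function.Periodic (fun x => q (e.symm x)) (2 * π) := by
    intro x
    have : e.symm (x + 2 * π) = e.symm x + T := by
      rw [← he (e.symm x + T), hθT, he']
    simp only [this, hqT _]
  have h0T : θ T = θ 0 + 2 * π := by simpa using hθT 0
  have hmean' := integral_comp_mul_deriv (a := 0) (b := T) (g := fun x => q (e.symm x))
    (fun t _ => hθ t) hθ'.continuousOn (hqc.comp hec)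
  have hsq := integral_comp_mul_deriv (a := 0) (b := T)
    (g := fun x => q (e.symm x) ^ 2 - m (e.symm x) ^ 2)
    (fun t _ => hθ t) hθ'.continuousOn (((hqc.comp hec).pow 2).sub ((hm.comp hec).pow 2))
  simp only [Function.comp_def, he, h0T] at hmean' hsq
  rw [hsq]
  exact integral_sq_sub_deriv_sq_nonpos hp (hm.comp hec) hperp (hmean' ▸ hmean)

/-- The area bounded by a front track whose rear track is closed and has signed length zero. -/
lemma integral_cross_le_of_integral_cos_eq_zero {x y θ α : ℝ → ℝ} {c T : ℝ} (hc : 0 < c)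
    (hα : Continuous α) (hαI : ∀ t, α t ∈ Ioo 0 π)
    (hθ : ∀ t, HasDerivAt θ (c * Real.sin (α t)) t) (hθT : ∀ t, θ (t + T) = θ t + 2 * π)
    (hx : ∀ t, HasDerivAt x (Real.cos (θ t + α t)) t)
    (hy : ∀ t, HasDerivAt y (Real.sin (θ t + α t)) t)
    (hxT : Function.Periodic x T) (hyT : Function.Periodic y T)
    (hcos : ∫ t in (0 : ℝ)..T, Real.cos (α t) = 0) :
    ∫ t in (0 : ℝ)..T, (x t * Real.sin (θ t + α t) - y t * Real.cos (θ t + α t)) ≤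
      2 * π / c ^ 2 := by
  have hθc : Continuous θ := continuous_iff_continuousAt.2 fun t => (hθ t).continuousAt
  have hxc : Continuous x := continuous_iff_continuousAt.2 fun t => (hx t).continuousAt
  have hyc : Continuous y := continuous_iff_continuousAt.2 fun t => (hy t).continuousAt
  have hpos : ∀ t, 0 < c * Real.sin (α t) := fun t =>
    mul_pos hc (Real.sin_pos_of_pos_of_lt_pi (hαI t).1 (hαI t).2)
  set q : ℝ → ℝ := fun t => x t * Real.sin (θ t) - y t * Real.cos (θ t) with hq
  set m : ℝ → ℝ := fun t => x t * Real.cos (θ t) + y t * Real.sin (θ t) - 1 / c with hm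
  have hcc : c * (1 / c) = 1 := by field_simp
  have hqd : ∀ t, HasDerivAt q (m t * (c * Real.sin (α t))) t := fun t => by
    refine (((hx t).mul (hθ t).sin).sub ((hy t).mul (hθ t).cos)).congr_deriv ?_
    simp only [hm]
    have hsc := Real.sin_sq_add_cos_sq (θ t)
    rw [Real.cos_add, Real.sin_add]
    linear_combination (-Real.sin (α t)) * hsc + Real.sin (α t) * hcc
  have hmd : ∀ t, HasDerivAt m (Real.cos (α t) - q t * (c * Real.sin (α t))) t := fun t => by
    refine ((((hx t).mul (hθ t).cos).add ((hy t).mul (hθ t).sin)).sub_const _).congr_deriv ?_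
    simp only [hq]
    have hsc := Real.sin_sq_add_cos_sq (θ t)
    rw [Real.cos_add, Real.sin_add]
    linear_combination (Real.cos (α t)) * hsc
  have hqc : Continuous q := by fun_prop
  have hmc : Continuous m := by fun_prop
  have hqT : Function.Periodic q T := fun t => by
    simp only [hq, hxT t, hyT t, hθT, Real.sin_add_two_pi, Real.cos_add_two_pi]
  have hmT : Function.Periodic m T := fun t => by
    simp only [hm, hxT t, hyT t, hθT, Real.sin_add_two_pi, Real.cos_add_two_pi]
  have hq0 : q T = q 0 := by simpa using hqT 0
  have hm0 : m T = m 0 := by simpa using hmT 0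
  have hθ0 : θ T = θ 0 + 2 * π := by simpa using hθT 0
  have hmean : ∫ t in (0 : ℝ)..T, q t * (c * Real.sin (α t)) = 0 := by
    have h := integral_eq_sub_of_hasDerivAt (a := 0) (b := T) (fun t _ => hmd t)
      (Continuous.intervalIntegrable (by fun_prop) _ _)
    rw [integral_sub (Continuous.intervalIntegrable (by fun_prop) _ _)
      (Continuous.intervalIntegrable (by fun_prop) _ _), hcos, hm0] at h
    linarith
  have hW := integral_sq_sub_sq_mul_deriv_nonpos hθ (by fun_prop) hpos hθT hqd hmc hqT hmean
  have hprim : ∀ t, HasDerivAt (fun t => q t * m t + 1 / c * q t + (1 / c) ^ 2 * θ t)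
      ((x t * Real.sin (θ t + α t) - y t * Real.cos (θ t + α t))
        - (q t ^ 2 - m t ^ 2) * (c * Real.sin (α t))) t := fun t => by
    refine ((((hqd t).mul (hmd t)).add ((hqd t).const_mul (1 / c))).add
      ((hθ t).const_mul ((1 / c) ^ 2))).congr_deriv ?_
    rw [Real.cos_add, Real.sin_add]
    have hr : x t * Real.cos (θ t) + y t * Real.sin (θ t) = m t + 1 / c := by simp [hm]
    have hr2 : x t * Real.sin (θ t) - y t * Real.cos (θ t) = q t := rfl
    linear_combination (-Real.sin (α t)) * hr - Real.cos (α t) * hr2 +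
      (Real.sin (α t) * (m t + 1 / c)) * hcc
  have h := integral_eq_sub_of_hasDerivAt (a := 0) (b := T) (fun t _ => hprim t)
    (Continuous.intervalIntegrable (by fun_prop) _ _)
  rw [integral_sub (Continuous.intervalIntegrable (by fun_prop) _ _)
    (Continuous.intervalIntegrable (by fun_prop) _ _), hq0, hm0, hθ0] at h
  have : (1 / c) ^ 2 * (2 * π) = 2 * π / c ^ 2 := by field_simp
  linarith

/-- A family of steering angles parametrized by the inverse bicycle length and the initial angle,
whose value at time `T` depends continuously on the parameters. -/
lemma exists_steering_family {k : ℝ → ℝ} (hk : Continuous k) {T : ℝ} (hT : 0 ≤ T) :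
    ∃ s : ℝ → ℝ → ℝ → ℝ, (∀ c a, s c a 0 = a) ∧ (∀ c a, IsSteering k c (s c a)) ∧
      Continuous fun p : ℝ × ℝ => s p.1 p.2 T := by
  choose s hs0 hs using fun c a => exists_steering hk c a
  refine ⟨s, hs0, hs, continuous_iff_continuousAt.2 fun p => ?_⟩
  have hcont : Continuous fun r : ℝ × ℝ => gronwallBound |p.2 - r.2| |p.1| |p.1 - r.1| T := by
    unfold gronwallBound
    split_ifs <;> fun_prop
  have hlim := hcont.tendsto p
  simp only [sub_self, abs_zero, gronwallBound_ε0_δ0] at hlim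
  refine tendsto_iff_dist_tendsto_zero.2 (squeeze_zero (fun _ => dist_nonneg) (fun r => ?_) hlim)
  have := (hs p.1 p.2).abs_sub_le (hs r.1 r.2) T ⟨hT, le_rfl⟩
  rwa [hs0, hs0, ← Real.dist_eq, dist_comm] at this

lemma IsSteering.periodic {k : ℝ → ℝ} {c T : ℝ} {α : ℝ → ℝ} (hα : IsSteering k c α)
    (hkT : Function.Periodic k T) (h : α T = α 0) : Function.Periodic α T := fun t =>
  congrFun ((hα.shift hkT).eq_of_eq hα (t₀ := 0) (by simpa using h)) t

lemma IsSteering.exists_add_mem_Ico {k : ℝ → ℝ} {c : ℝ} {α : ℝ → ℝ} (hα : IsSteering k c α) :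
    ∃ b : ℝ, IsSteering k c (fun t => α t + b) ∧ α 0 + b ∈ Ico 0 (2 * π) := by
  refine ⟨_, hα.add_two_pi (-toIcoDiv Real.two_pi_pos 0 (α 0)), ?_⟩
  have h := sub_toIcoDiv_zsmul_mem_Ico Real.two_pi_pos 0 (α 0)
  rw [zero_add, zsmul_eq_mul] at h
  push_cast
  rwa [neg_mul, ← sub_eq_add_neg]

/-- If the monodromy never turns backwards, then its fixed points are neutral. -/
lemma IsSteering.integral_cos_eq_zero {k : ℝ → ℝ} {c T : ℝ} {α : ℝ → ℝ} (hα : IsSteering k c α)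
    (hk : Continuous k) (hc : 0 < c) (hT : 0 < T) (hαT : α T = α 0)
    (h : ∀ β, IsSteering k c β → β 0 ≤ β T) : ∫ t in (0 : ℝ)..T, Real.cos (α t) = 0 := by
  set I := ∫ t in (0 : ℝ)..T, Real.cos (α t) with hI
  set E := Real.exp (c * T) with hE
  have hE0 : 0 < E := Real.exp_pos _
  have key : ∀ δ : ℝ, |δ| * E ≤ 1 → ∃ J : ℝ, |J - 2 * I| ≤ |δ| * E * T ∧
      (0 < δ → J ≤ 0) ∧ (δ < 0 → 0 ≤ J) := by
    intro δ hδ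
    obtain ⟨β, hβ0, hβ⟩ := exists_steering hk c (α 0 + δ)
    have hclose : ∀ t ∈ Icc 0 T, |β t - α t| ≤ |δ| * E := fun t ht => by
      have := hβ.abs_sub_le hα t ht
      rw [hβ0, add_sub_cancel_left, sub_self, abs_zero, gronwallBound_ε0, abs_of_pos hc] at this
      refine this.trans (mul_le_mul_of_nonneg_left (Real.exp_le_exp.2 ?_) (abs_nonneg _))
      exact mul_le_mul_of_nonneg_left ht.2 hc.le
    have hδ1 : |δ| ≤ |δ| * E :=
      le_mul_of_one_le_right (abs_nonneg _) (Real.one_le_exp (by positivity))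
    have hαc := hα.continuous
    have hβc := hβ.continuous
    have hmain := hβ.sin_half_sub hα T
    rw [hβ0, add_sub_cancel_left] at hmain
    have hle : δ ≤ β T - α T := by linarith [h β hβ]
    have hbd := abs_le.1 ((hclose T ⟨hT.le, le_rfl⟩).trans hδ)
    have hbd' := abs_le.1 (hδ1.trans hδ)
    have hsin : Real.sin (δ / 2) ≤ Real.sin ((β T - α T) / 2) :=
      Real.sin_le_sin_of_le_of_le_pi_div_two (by linarith [pi_gt_three])
        (by linarith [pi_gt_three]) (by linarith)
    rw [hmain] at hsin
    refine ⟨∫ s in (0 : ℝ)..T, (Real.cos (β s) + Real.cos (α s)), ?_, fun hpos => ?_,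
      fun hneg => ?_⟩
    · rw [show 2 * I = ∫ s in (0 : ℝ)..T, 2 * Real.cos (α s) by rw [integral_const_mul],
        ← integral_sub (Continuous.intervalIntegrable (by fun_prop) _ _)
          (Continuous.intervalIntegrable (by fun_prop) _ _), ← Real.norm_eq_abs]
      have := norm_integral_le_of_norm_le_const (a := 0) (b := T) (C := |δ| * E)
        (f := fun s => Real.cos (β s) + Real.cos (α s) - 2 * Real.cos (α s)) fun s hs => ?_
      · rwa [sub_zero, abs_of_pos hT] at this
      · rw [uIoc_of_le hT.le] at hs
        rw [show Real.cos (β s) + Real.cos (α s) - 2 * Real.cos (α s) =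
          Real.cos (β s) - Real.cos (α s) by ring, Real.norm_eq_abs]
        exact (Real.abs_cos_sub_cos_le _ _).trans (hclose s ⟨hs.1.le, hs.2⟩)
    · have hs : 0 < Real.sin (δ / 2) :=
        Real.sin_pos_of_pos_of_lt_pi (by linarith) (by linarith [pi_gt_three])
      have := Real.one_le_exp_iff.1 (le_of_mul_le_mul_left (by simpa using hsin) hs)
      by_contra! hJ
      linarith [mul_pos (half_pos hc) hJ]
    · have hs : Real.sin (δ / 2) < 0 :=
        Real.sin_neg_of_neg_of_neg_pi_lt (by linarith) (by linarith [pi_gt_three])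
      have : Real.exp (-(c / 2 * ∫ s in (0 : ℝ)..T, (Real.cos (β s) + Real.cos (α s)))) ≤ 1 := by
        by_contra! hlt
        nlinarith
      have := Real.exp_le_one_iff.1 this
      by_contra! hJ
      linarith [mul_neg_of_pos_of_neg (half_pos hc) hJ]
  by_contra hI0
  set δ := min (1 / E) (|I| / (E * T)) with hδ
  have hδ0 : 0 < δ := lt_min (by positivity) (by positivity)
  have h1 : δ * E ≤ 1 := (le_div_iff₀ hE0).1 (min_le_left _ _)
  have h2 : δ * E * T ≤ |I| := by
    rw [mul_assoc]; exact (le_div_iff₀ (by positivity)).1 (min_le_right _ _)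
  rcases lt_or_gt_of_ne hI0 with hneg | hpos
  · obtain ⟨J, hJ1, -, hJ2⟩ := key (-δ) (by rwa [abs_neg, abs_of_pos hδ0])
    rw [abs_neg, abs_of_pos hδ0] at hJ1
    rw [abs_of_neg hneg] at h2
    linarith [hJ2 (by linarith), (abs_le.1 hJ1).2]
  · obtain ⟨J, hJ1, hJ2, -⟩ := key δ (by rwa [abs_of_pos hδ0])
    rw [abs_of_pos hδ0] at hJ1
    rw [abs_of_pos hpos] at h2
    linarith [hJ2 hδ0, (abs_le.1 hJ1).1]

/-- If the monodromy never turns backwards, then some shorter bicycle has a closed rear track of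
signed length zero. -/
lemma exists_closed_steering_integral_cos_eq_zero {k : ℝ → ℝ} {c T : ℝ} (hk : Continuous k)
    (hkT : Function.Periodic k T) (hc : 0 < c) (hT : 0 < T)
    (h : ∀ α, IsSteering k c α → α 0 ≤ α T) :
    ∃ c', c ≤ c' ∧ ∃ α, IsSteering k c' α ∧ Function.Periodic α T ∧ α 0 ∈ Icc 0 (2 * π) ∧
      ∫ t in (0 : ℝ)..T, Real.cos (α t) = 0 := by
  obtain ⟨s, hs0, hs, hcont⟩ := exists_steering_family hk hT.le
  have hcont' : Continuous fun p : ℝ × ℝ => s p.1 p.2 T - p.2 := hcont.sub continuous_snd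
  have hDc : ∀ c, Continuous fun a => s c a T - a := fun c =>
    hcont'.comp (Continuous.prodMk_right c)
  have hK : IsCompact (Icc 0 (2 * π)) := isCompact_Icc
  have hm := hK.continuous_sInf (f := fun c a => s c a T - a) hcont'
  have hne : (Icc 0 (2 * π)).Nonempty := nonempty_Icc.2 (by positivity)
  obtain ⟨C, hC⟩ := (isCompact_Icc (a := 0) (b := T)).exists_bound_of_continuousOn hk.continuousOn
  set M := max c (C + 1) with hM
  have hend : s M (π / 2) T ≤ π / 2 := by
    refine image_le_of_deriv_right_lt_deriv_boundary (B := fun _ => π / 2) (B' := fun _ => 0)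
      (a := 0) (b := T) (hs M _).continuous.continuousOn
      (fun t _ => (hs M _ t).hasDerivWithinAt) (hs0 _ _).le
      (fun _ => hasDerivAt_const _ _) (fun t ht heq => ?_) ⟨hT.le, le_rfl⟩
    rw [heq, Real.sin_pi_div_two]
    have := (le_abs_self _).trans (hC t (Ico_subset_Icc_self ht))
    linarith [le_max_right c (C + 1)]
  have hmM : sInf ((fun a => s M a T - a) '' Icc 0 (2 * π)) ≤ 0 := by
    refine (csInf_le (hK.image (hDc M)).bddBelow
      ⟨π / 2, ⟨by positivity, by linarith [pi_pos]⟩, rfl⟩).trans ?_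
    linarith
  have hmc : 0 ≤ sInf ((fun a => s c a T - a) '' Icc 0 (2 * π)) := by
    refine le_csInf (hne.image _) ?_
    rintro _ ⟨a, -, rfl⟩
    have := h _ (hs c a)
    rw [hs0] at this
    linarith
  obtain ⟨c', hc', hmc'⟩ :=
    intermediate_value_Icc' (le_max_left c (C + 1)) hm.continuousOn ⟨hmM, hmc⟩
  simp only at hmc'
  obtain ⟨a, ha, hDa⟩ := hK.exists_sInf_image_eq hne (hDc c').continuousOn
  rw [hmc'] at hDa
  have hmin : ∀ β, IsSteering k c' β → β 0 ≤ β T := fun β hβ => by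
    obtain ⟨b, hb, hb0⟩ := hβ.exists_add_mem_Ico
    have h1 : (0 : ℝ) ≤ s c' (β 0 + b) T - (β 0 + b) :=
      hmc'.ge.trans (csInf_le (hK.image (hDc c')).bddBelow ⟨_, Ico_subset_Icc_self hb0, rfl⟩)
    rw [(hs c' (β 0 + b)).eq_of_eq hb (t₀ := 0) (hs0 _ _)] at h1
    linarith
  have hfix : s c' a T = s c' a 0 := by rw [hs0]; linarith
  exact ⟨c', hc'.1, s c' a, hs c' a, (hs c' a).periodic hkT hfix, by rwa [hs0],
    (hs c' a).integral_cos_eq_zero hk (hc.trans_le hc'.1) hT hfix hmin⟩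

/-- If the monodromy turns some steering angle backwards, then it is hyperbolic. -/
lemma exists_hyperbolic_of_lt {k : ℝ → ℝ} {c T : ℝ} (hk : Continuous k)
    (hkT : Function.Periodic k T) (hkpos : ∀ t, 0 < k t) (hc : 0 < c) (hT : 0 < T) {γ : ℝ → ℝ}
    (hγ : IsSteering k c γ) (hγT : γ T < γ 0) :
    ∃ α₁ α₂, IsSteering k c α₁ ∧ IsSteering k c α₂ ∧ Function.Periodic α₁ T ∧
      Function.Periodic α₂ T ∧ 0 < α₁ 0 ∧ α₁ 0 < α₂ 0 ∧ α₂ 0 < π ∧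
      0 < (∫ t in (0 : ℝ)..T, Real.cos (α₁ t)) ∧ (∫ t in (0 : ℝ)..T, Real.cos (α₂ t)) < 0 := by
  obtain ⟨s, hs0, hs, hcont⟩ := exists_steering_family hk hT.le
  have hD : Continuous fun a => s c a T - a :=
    (hcont.comp (Continuous.prodMk_right c)).sub continuous_id
  obtain ⟨b, hb, hb0⟩ := hγ.exists_add_mem_Ico
  have hDb : s c (γ 0 + b) T - (γ 0 + b) < 0 := by
    rw [(hs c (γ 0 + b)).eq_of_eq hb (t₀ := 0) (hs0 _ _)]
    linarith
  have hD0 : 0 < s c 0 T - 0 := by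
    have := (hs c 0).int_mul_pi_lt hkpos 0 hT (by simp [hs0])
    simpa using this
  have hD2 : 0 < s c (2 * π) T - 2 * π := by
    have := (hs c (2 * π)).int_mul_pi_lt hkpos 2 hT (by simp [hs0])
    push_cast at this
    linarith
  obtain ⟨a₁, ha₁, h₁⟩ := intermediate_value_Ioo' hb0.1 hD.continuousOn ⟨hDb, hD0⟩
  obtain ⟨a₂, ha₂, h₂⟩ := intermediate_value_Ioo hb0.2.le hD.continuousOn ⟨hDb, hD2⟩
  have hp₁ := (hs c a₁).periodic hkT (by rw [hs0]; linarith)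
  have hp₂ := (hs c a₂).periodic hkT (by rw [hs0]; linarith)
  have hI₁ := (hs c a₁).mem_Ioo_of_periodic hkpos hc hT hp₁
    (by rw [hs0]; exact ⟨ha₁.1.le, by linarith [ha₁.2, hb0.2]⟩)
  have hI₂ := (hs c a₂).mem_Ioo_of_periodic hkpos hc hT hp₂
    (by rw [hs0]; exact ⟨by linarith [ha₂.1, hb0.1], ha₂.2.le⟩)
  have hlt0 : a₁ < a₂ := ha₁.2.trans ha₂.1
  have h01 := hI₁ 0
  have h02 := hI₂ 0
  rw [hs0] at h01 h02
  have hsin0 : Real.sin ((a₁ - a₂) / 2) < 0 :=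
    Real.sin_neg_of_neg_of_neg_pi_lt (by linarith) (by linarith [h01.1, h02.2])
  have hlt : ∀ t, s c a₁ t < s c a₂ t := fun t => by
    have hmain := (hs c a₁).sin_half_sub (hs c a₂) t
    rw [hs0, hs0] at hmain
    by_contra! hle
    have : 0 ≤ Real.sin ((s c a₁ t - s c a₂ t) / 2) :=
      Real.sin_nonneg_of_nonneg_of_le_pi (by linarith) (by linarith [(hI₁ t).2, (hI₂ t).1])
    rw [hmain] at this
    exact absurd this (not_le.2 (mul_neg_of_neg_of_pos hsin0 (Real.exp_pos _)))
  have hc₁ := (hs c a₁).continuous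
  have hc₂ := (hs c a₂).continuous
  have hi₁ : IntervalIntegrable (fun t => Real.cos (s c a₁ t)) MeasureTheory.volume 0 T :=
    Continuous.intervalIntegrable (by fun_prop) _ _
  have hi₂ : IntervalIntegrable (fun t => Real.cos (s c a₂ t)) MeasureTheory.volume 0 T :=
    Continuous.intervalIntegrable (by fun_prop) _ _
  have hsum : (∫ t in (0 : ℝ)..T, Real.cos (s c a₁ t)) +
      ∫ t in (0 : ℝ)..T, Real.cos (s c a₂ t) = 0 := by
    have hmain := (hs c a₁).sin_half_sub (hs c a₂) T
    have e₁ : s c a₁ T = s c a₁ 0 := by simpa using hp₁ 0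
    have e₂ : s c a₂ T = s c a₂ 0 := by simpa using hp₂ 0
    rw [e₁, e₂, hs0, hs0, eq_comm, mul_eq_left₀ hsin0.ne, Real.exp_eq_one_iff, neg_eq_zero,
      integral_add hi₁ hi₂] at hmain
    exact (mul_eq_zero.1 hmain).resolve_left (half_pos hc).ne'
  have hint : ∫ t in (0 : ℝ)..T, Real.cos (s c a₂ t) < ∫ t in (0 : ℝ)..T, Real.cos (s c a₁ t) :=
    integral_lt_integral_of_continuousOn_of_le_of_exists_lt hT
      (Continuous.continuousOn (by fun_prop)) (Continuous.continuousOn (by fun_prop))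
      (fun t _ => (Real.cos_lt_cos_of_nonneg_of_le_pi (hI₁ t).1.le (hI₂ t).2.le (hlt t)).le)
      ⟨0, ⟨le_rfl, hT.le⟩,
        Real.cos_lt_cos_of_nonneg_of_le_pi (hI₁ 0).1.le (hI₂ 0).2.le (hlt 0)⟩
  refine ⟨s c a₁, s c a₂, hs _ _, hs _ _, hp₁, hp₂, (hI₁ 0).1, hlt 0, (hI₂ 0).2, ?_, ?_⟩ <;>
    linarith

/-- The tangent angle of a curve of unit speed. -/
lemma exists_tangent_angle {u v u' v' k : ℝ → ℝ} (hu : ∀ t, HasDerivAt u (u' t) t)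
    (hv : ∀ t, HasDerivAt v (v' t) t) (hunit : ∀ t, u t ^ 2 + v t ^ 2 = 1)
    (hk : ∀ t, k t = u t * v' t - v t * u' t) (hkc : Continuous k) :
    ∃ φ : ℝ → ℝ, (∀ t, HasDerivAt φ (k t) t) ∧ (∀ t, u t = Real.cos (φ t)) ∧
      ∀ t, v t = Real.sin (φ t) := by
  set z : ℂ := ⟨u 0, v 0⟩ with hz
  have hz1 : ‖z‖ = 1 := by
    rw [Complex.norm_eq_sqrt_sq_add_sq, hz, hunit 0, Real.sqrt_one]
  have hcos : Real.cos z.arg = u 0 := by simpa [hz1] using Complex.norm_mul_cos_arg z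
  have hsin : Real.sin z.arg = v 0 := by simpa [hz1] using Complex.norm_mul_sin_arg z
  set φ : ℝ → ℝ := fun t => z.arg + ∫ s in (0 : ℝ)..t, k s with hφ
  have hφd : ∀ t, HasDerivAt φ (k t) t := fun t =>
    ((hkc.integral_hasStrictDerivAt 0 t).hasDerivAt).const_add _
  have hφ0 : φ 0 = z.arg := by simp [hφ]
  have horth : ∀ t, u t * u' t + v t * v' t = 0 := fun t => by
    have h1 := ((hu t).pow 2).add ((hv t).pow 2)
    have h2 : u ^ 2 + v ^ 2 = fun _ => 1 := funext hunit
    rw [h2] at h1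
    have h3 := h1.unique (hasDerivAt_const t 1)
    push_cast at h3
    linarith
  have hu' : ∀ t, u' t = -(k t * v t) := fun t => by
    rw [hk]
    linear_combination (-u' t) * hunit t + u t * horth t
  have hv' : ∀ t, v' t = k t * u t := fun t => by
    rw [hk]
    linear_combination (-v' t) * hunit t + v t * horth t
  have h1 : ∀ t, HasDerivAt (fun t => u t * Real.cos (φ t) + v t * Real.sin (φ t)) 0 t :=
    fun t => by
      refine (((hu t).mul (hφd t).cos).add ((hv t).mul (hφd t).sin)).congr_deriv ?_
      rw [hu', hv']; ring
  have h2 : ∀ t, HasDerivAt (fun t => v t * Real.cos (φ t) - u t * Real.sin (φ t)) 0 t :=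
    fun t => by
      refine (((hv t).mul (hφd t).cos).sub ((hu t).mul (hφd t).sin)).congr_deriv ?_
      rw [hu', hv']; ring
  have e1 : ∀ t, u t * Real.cos (φ t) + v t * Real.sin (φ t) = 1 := fun t => by
    rw [is_const_of_deriv_eq_zero (fun t => (h1 t).differentiableAt) (fun t => (h1 t).deriv) t 0,
      hφ0, hcos, hsin]
    linarith [hunit 0]
  have e2 : ∀ t, v t * Real.cos (φ t) - u t * Real.sin (φ t) = 0 := fun t => by
    rw [is_const_of_deriv_eq_zero (fun t => (h2 t).differentiableAt) (fun t => (h2 t).deriv) t 0,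
      hφ0, hcos, hsin]
    ring
  refine ⟨φ, hφd, fun t => ?_, fun t => ?_⟩
  · linear_combination Real.cos (φ t) * e1 t - Real.sin (φ t) * e2 t -
      u t * Real.sin_sq_add_cos_sq (φ t)
  · linear_combination Real.sin (φ t) * e1 t + Real.cos (φ t) * e2 t -
      v t * Real.sin_sq_add_cos_sq (φ t)

lemma Function.Periodic.of_hasDerivAt {E : Type*} [NormedAddCommGroup E] [NormedSpace ℝ E]
    {f f' : ℝ → E} {T : ℝ} (hf : ∀ t, HasDerivAt f (f' t) t) (hT : Function.Periodic f T) :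
    Function.Periodic f' T := fun t => by
  have h := (hf (t + T)).comp_add_const t T
  rw [show (fun t => f (t + T)) = f from funext hT] at h
  exact h.unique (hf t)


/-- Menzin's conjecture for convex curves: if the front track `F` is a simple closed,
positively oriented, strictly convex `C²` curve enclosing area `A > πℓ²`, then the
bicycle monodromy is hyperbolic, with an attracting fixed point (closed rear track of
positive signed length) and a repelling one (negative signed length). -/
theorem menzin_conjecture_convex
    (ℓ : ℝ) (hℓ : 0 < ℓ) (T : ℝ) (hT : 0 < T)
    (F F' F'' : ℝ → ℝ × ℝ)
    (hF' : ∀ t, HasDerivAt F (F' t) t)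
    (hF'' : ∀ t, HasDerivAt F' (F'' t) t)
    (hC2 : Continuous F'')
    (hper : ∀ t, F (t + T) = F t)
    (hunit : ∀ t, (F' t).1 ^ 2 + (F' t).2 ^ 2 = 1)
    (hinj : InjOn F (Ico 0 T))
    (k : ℝ → ℝ)
    (hk : ∀ t, k t = (F' t).1 * (F'' t).2 - (F' t).2 * (F'' t).1)
    (hconvex : ∀ t, 0 < k t)
    (horient : ∫ t in (0 : ℝ)..T, k t = 2 * Real.pi)
    (A : ℝ)
    (hA : A = (1 / 2) * ∫ t in (0 : ℝ)..T, ((F t).1 * (F' t).2 - (F t).2 * (F' t).1))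
    (hbig : Real.pi * ℓ ^ 2 < A) :
    ∃ α₁ α₂ : ℝ → ℝ,
      (∀ t, HasDerivAt α₁ (k t - Real.sin (α₁ t) / ℓ) t) ∧
      (∀ t, HasDerivAt α₂ (k t - Real.sin (α₂ t) / ℓ) t) ∧
      (∀ t, ∃ n : ℤ, α₁ (t + T) - α₁ t = 2 * Real.pi * n) ∧
      (∀ t, ∃ n : ℤ, α₂ (t + T) - α₂ t = 2 * Real.pi * n) ∧
      (¬ ∃ n : ℤ, α₁ 0 - α₂ 0 = 2 * Real.pi * n) ∧
      0 < (∫ t in (0 : ℝ)..T, Real.cos (α₁ t)) ∧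
      (∫ t in (0 : ℝ)..T, Real.cos (α₂ t)) < 0 := by
  have hkc : Continuous k := by
    have hF'c : Continuous F' := continuous_iff_continuousAt.2 fun t => (hF'' t).continuousAt
    rw [show k = fun t => (F' t).1 * (F'' t).2 - (F' t).2 * (F'' t).1 from funext hk]
    fun_prop
  have hF'T : Function.Periodic F' T := .of_hasDerivAt hF' hper
  have hF''T : Function.Periodic F'' T := .of_hasDerivAt hF'' hF'T
  have hkT : Function.Periodic k T := fun t => by rw [hk, hk, hF'T, hF''T]
  have hsteer : ∀ α, IsSteering k ℓ⁻¹ α ↔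
      ∀ t, HasDerivAt α (k t - Real.sin (α t) / ℓ) t := fun α => by
    simp only [IsSteering, div_eq_inv_mul]
  obtain ⟨γ, hγ, hγT⟩ : ∃ γ, IsSteering k ℓ⁻¹ γ ∧ γ T < γ 0 := by
    by_contra! hno
    obtain ⟨c, hc, α, hα, hαT, hα0, hcos⟩ :=
      exists_closed_steering_integral_cos_eq_zero hkc hkT (inv_pos.2 hℓ) hT hno
    have hc0 : 0 < c := (inv_pos.2 hℓ).trans_le hc
    obtain ⟨φ, hφ, hφ1, hφ2⟩ := exists_tangent_angle (fun t => (hF'' t).fst)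
      (fun t => (hF'' t).snd) hunit hk hkc
    have hφT : ∀ t, φ (t + T) = φ t + 2 * π := fun t => by
      have hd : ∀ t, HasDerivAt (fun t => φ (t + T) - φ t) 0 t := fun t => by
        exact (((hφ (t + T)).comp_add_const t T).sub (hφ t)).congr_deriv (by rw [hkT, sub_self])
      have h1 := is_const_of_deriv_eq_zero (fun t => (hd t).differentiableAt)
        (fun t => (hd t).deriv) t 0
      have h2 := integral_eq_sub_of_hasDerivAt (a := 0) (b := T) (fun t _ => hφ t)
        (hkc.intervalIntegrable _ _)
      simp only [zero_add] at h1
      linarith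
    have hadd : ∀ t, φ t - α t + α t = φ t := fun t => sub_add_cancel _ _
    have harea := integral_cross_le_of_integral_cos_eq_zero (x := fun t => (F t).1)
      (y := fun t => (F t).2) (θ := fun t => φ t - α t) (T := T) hc0 hα.continuous
      (hα.mem_Ioo_of_periodic hconvex hc0 hT hαT hα0)
      (fun t => ((hφ t).sub (hα t)).congr_deriv (by ring))
      (fun t => by rw [hφT, hαT]; ring)
      (fun t => by rw [hadd, ← hφ1]; exact (hF' t).fst)
      (fun t => by rw [hadd, ← hφ2]; exact (hF' t).snd)
      (fun t => by simp only [hper t]) (fun t => by simp only [hper t]) hcos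
    simp only [hadd, ← hφ1, ← hφ2] at harea
    have hcl : 1 / c ^ 2 ≤ ℓ ^ 2 := by
      rw [one_div, ← inv_pow]
      exact pow_le_pow_left₀ (by positivity) (inv_le_of_inv_le₀ hℓ hc) 2
    have : 2 * π / c ^ 2 = 2 * (π * (1 / c ^ 2)) := by ring
    linarith [mul_le_mul_of_nonneg_left hcl pi_pos.le]
  obtain ⟨α₁, α₂, h₁, h₂, hp₁, hp₂, h0, h12, hpi, hpos, hneg⟩ :=
    exists_hyperbolic_of_lt hkc hkT hconvex (inv_pos.2 hℓ) hT hγ hγT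
  refine ⟨α₁, α₂, (hsteer α₁).1 h₁, (hsteer α₂).1 h₂, fun t => ⟨0, by simp [hp₁ t]⟩,
    fun t => ⟨0, by simp [hp₂ t]⟩, ?_, hpos, hneg⟩
  rintro ⟨n, hn⟩
  have hn0 : (n : ℝ) < 0 := by
    by_contra! h
    linarith [mul_nonneg Real.two_pi_pos.le h]
  have hn1 : (-1 : ℝ) < n := by
    by_contra! h
    linarith [mul_le_mul_of_nonneg_left h Real.two_pi_pos.le]
  have hn0' : n < 0 := by exact_mod_cast hn0
  have hn1' : -1 < n := by exact_mod_cast hn1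
  omega
end

section
/- Let ℓ ∈ ℝ, T > 0, n ∈ ℤ, and let x, y, θ : ℝ → ℝ be continuously differentiable with x(T) = x(0), y(T) = y(0), and θ(T) = θ(0) + 2πn. Define X(t) = x(t) + ℓ·cos θ(t) and Y(t) = y(t) + ℓ·sin θ(t). Then the signed areas A_F = (1/2)·∫₀ᵀ (X·Y' − Y·X') dt and A_R = (1/2)·∫₀ᵀ (x·y' − y·x') dt satisfy A_F − A_R = ℓ·∫₀ᵀ (cos θ(t)·y'(t) − sin θ(t)·x'(t)) dt + (ℓ²/2)·∫₀ᵀ θ'(t) dt = ℓ·∫₀ᵀ (cos θ·y' − sin θ·x') dt + π·ℓ²·n. -/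
open Real intervalIntegral

/-- The area forms of the two endpoints of a moving segment differ by multiples of the constraint
form and the turning form, up to an exact form. -/
theorem hasDerivAt_segment_moment {x y θ : ℝ → ℝ} {x' y' θ' t : ℝ} (ℓ : ℝ)
    (hx : HasDerivAt x x' t) (hy : HasDerivAt y y' t) (hθ : HasDerivAt θ θ' t) :
    HasDerivAt (fun s => ℓ * (x s * Real.sin (θ s) - y s * Real.cos (θ s)))
      (((x t + ℓ * Real.cos (θ t)) * (y' + ℓ * (Real.cos (θ t) * θ'))
          - (y t + ℓ * Real.sin (θ t)) * (x' + ℓ * (-Real.sin (θ t) * θ')))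
        - (x t * y' - y t * x') - 2 * ℓ * (Real.cos (θ t) * y' - Real.sin (θ t) * x')
        - ℓ ^ 2 * θ') t := by
  refine (((hx.mul hθ.sin).sub (hy.mul hθ.cos)).const_mul ℓ).congr_deriv ?_
  linear_combination -ℓ ^ 2 * θ' * Real.sin_sq_add_cos_sq (θ t)

/-- The area formula for a closed motion of a segment of length `ℓ`:
`A_F − A_R = ℓ·∫λ + (ℓ²/2)·∫dθ`, where `λ = cos θ·dy − sin θ·dx` measures the violation
of the bicycle constraint and `∫dθ = 2πn` is the total turning of the segment. -/
theorem segment_area_formula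
    (ℓ T : ℝ) (hT : 0 < T) (n : ℤ)
    (x y θ x' y' θ' : ℝ → ℝ)
    (hx : ∀ t, HasDerivAt x (x' t) t)
    (hy : ∀ t, HasDerivAt y (y' t) t)
    (hθ : ∀ t, HasDerivAt θ (θ' t) t)
    (hx' : Continuous x') (hy' : Continuous y') (hθ' : Continuous θ')
    (hxT : x T = x 0) (hyT : y T = y 0)
    (hθT : θ T = θ 0 + 2 * Real.pi * n)
    (X Y : ℝ → ℝ)
    (hX : ∀ t, X t = x t + ℓ * Real.cos (θ t))
    (hY : ∀ t, Y t = y t + ℓ * Real.sin (θ t)) :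
    (1 / 2) * (∫ t in (0 : ℝ)..T, (X t * deriv Y t - Y t * deriv X t))
      - (1 / 2) * (∫ t in (0 : ℝ)..T, (x t * y' t - y t * x' t))
    = ℓ * (∫ t in (0 : ℝ)..T, (Real.cos (θ t) * y' t - Real.sin (θ t) * x' t))
      + (ℓ ^ 2 / 2) * (∫ t in (0 : ℝ)..T, θ' t) ∧
    (1 / 2) * (∫ t in (0 : ℝ)..T, (X t * deriv Y t - Y t * deriv X t))
      - (1 / 2) * (∫ t in (0 : ℝ)..T, (x t * y' t - y t * x' t))
    = ℓ * (∫ t in (0 : ℝ)..T, (Real.cos (θ t) * y' t - Real.sin (θ t) * x' t))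
      + Real.pi * ℓ ^ 2 * n := by
  have hxc : Continuous x := continuous_iff_continuousAt.2 fun t => (hx t).continuousAt
  have hyc : Continuous y := continuous_iff_continuousAt.2 fun t => (hy t).continuousAt
  have hθc : Continuous θ := continuous_iff_continuousAt.2 fun t => (hθ t).continuousAt
  obtain rfl : X = fun t => x t + ℓ * Real.cos (θ t) := funext hX
  obtain rfl : Y = fun t => y t + ℓ * Real.sin (θ t) := funext hY
  have hdX (t : ℝ) : deriv (fun t => x t + ℓ * Real.cos (θ t)) t
      = x' t + ℓ * (-Real.sin (θ t) * θ' t) := ((hx t).add ((hθ t).cos.const_mul ℓ)).deriv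
  have hdY (t : ℝ) : deriv (fun t => y t + ℓ * Real.sin (θ t)) t
      = y' t + ℓ * (Real.cos (θ t) * θ' t) := ((hy t).add ((hθ t).sin.const_mul ℓ)).deriv
  simp only [hdX, hdY]
  have hturn : ∫ t in (0 : ℝ)..T, θ' t = 2 * Real.pi * n := by
    rw [integral_eq_sub_of_hasDerivAt (fun t _ => hθ t) (hθ'.intervalIntegrable _ _), hθT]
    ring
  have hsin : Real.sin (θ T) = Real.sin (θ 0) := by
    rw [hθT, mul_comm, Real.sin_add_int_mul_two_pi]
  have hcos : Real.cos (θ T) = Real.cos (θ 0) := by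
    rw [hθT, mul_comm, Real.cos_add_int_mul_two_pi]
  have hexact := integral_eq_sub_of_hasDerivAt (a := 0) (b := T)
    (fun t _ => hasDerivAt_segment_moment ℓ (hx t) (hy t) (hθ t))
    (Continuous.intervalIntegrable (by fun_prop) _ _)
  rw [integral_sub (Continuous.intervalIntegrable (by fun_prop) _ _)
      (Continuous.intervalIntegrable (by fun_prop) _ _),
    integral_sub (Continuous.intervalIntegrable (by fun_prop) _ _)
      (Continuous.intervalIntegrable (by fun_prop) _ _),
    integral_sub (Continuous.intervalIntegrable (by fun_prop) _ _)
      (Continuous.intervalIntegrable (by fun_prop) _ _),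
    integral_const_mul, integral_const_mul, hxT, hyT, hsin, hcos, sub_self] at hexact
  constructor
  · linear_combination hexact / 2
  · linear_combination hexact / 2 + ℓ ^ 2 / 2 * hturn
end

section
/- Let p : ℝ → ℝ be twice continuously differentiable and 2π-periodic. For t ∈ ℝ define the length and area of the equidistant curve (wave front) at distance t by L(t) = ∫₀^{2π} (p(φ) − t) dφ and A(t) = (1/2)·∫₀^{2π} ((p(φ) − t)² − p'(φ)²) dφ. Then L(t) = L(0) − 2πt and A(t) = A(0) − L(0)·t + π·t² for all t, and consequently the isoperimetric defect L(t)² − 4π·A(t) is independent of t: L(t)² − 4π·A(t) = L(0)² − 4π·A(0) for all t. -/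
open Real intervalIntegral

/-- The length of the curve with support function `p - t`. -/
theorem integral_support_sub_const {p : ℝ → ℝ} (hp : Continuous p) (t : ℝ) :
    ∫ φ in (0 : ℝ)..(2 * Real.pi), (p φ - t) =
      (∫ φ in (0 : ℝ)..(2 * Real.pi), p φ) - 2 * Real.pi * t := by
  rw [integral_sub (hp.intervalIntegrable _ _) (by simp), integral_const]
  simp

/-- Twice the area of the curve with support function `p - t`, where `q` is the derivative
of `p`. -/
theorem integral_support_sub_const_sq_sub_sq {p q : ℝ → ℝ} (hp : Continuous p)
    (hq : Continuous q) (t : ℝ) :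
    ∫ φ in (0 : ℝ)..(2 * Real.pi), ((p φ - t) ^ 2 - q φ ^ 2) =
      (∫ φ in (0 : ℝ)..(2 * Real.pi), (p φ ^ 2 - q φ ^ 2)) -
        2 * t * (∫ φ in (0 : ℝ)..(2 * Real.pi), p φ) + 2 * Real.pi * t ^ 2 := by
  have expand : ∀ φ, (p φ - t) ^ 2 - q φ ^ 2 = p φ ^ 2 - q φ ^ 2 - 2 * t * p φ + t ^ 2 :=
    fun φ => by ring
  have hpq : Continuous fun φ => p φ ^ 2 - q φ ^ 2 := by fun_prop
  have htp : Continuous fun φ => 2 * t * p φ := by fun_prop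
  have hsub : Continuous fun φ => p φ ^ 2 - q φ ^ 2 - 2 * t * p φ := hpq.sub htp
  simp_rw [expand]
  rw [integral_add (hsub.intervalIntegrable _ _) (by simp),
    integral_sub (hpq.intervalIntegrable _ _) (htp.intervalIntegrable _ _),
    integral_const_mul, integral_const]
  simp

/-- For equidistant curves (wave fronts) with support function `p − t`, the length and
area satisfy `L(t) = L(0) − 2πt` and `A(t) = A(0) − L(0)t + πt²`; consequently the
isoperimetric defect `L(t)² − 4πA(t)` is independent of `t`. -/
theorem equidistant_isoperimetric_defect
    (p p' p'' : ℝ → ℝ)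
    (hp : ∀ φ, HasDerivAt p (p' φ) φ)
    (hp' : ∀ φ, HasDerivAt p' (p'' φ) φ)
    (hC2 : Continuous p'')
    (hper : ∀ φ, p (φ + 2 * Real.pi) = p φ)
    (L A : ℝ → ℝ)
    (hL : ∀ t, L t = ∫ φ in (0 : ℝ)..(2 * Real.pi), (p φ - t))
    (hA : ∀ t, A t = (1 / 2) * ∫ φ in (0 : ℝ)..(2 * Real.pi), ((p φ - t) ^ 2 - p' φ ^ 2)) :
    (∀ t, L t = L 0 - 2 * Real.pi * t) ∧
    (∀ t, A t = A 0 - L 0 * t + Real.pi * t ^ 2) ∧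
    (∀ t, L t ^ 2 - 4 * Real.pi * A t = L 0 ^ 2 - 4 * Real.pi * A 0) := by
  have cp : Continuous p := continuous_iff_continuousAt.2 fun φ => (hp φ).continuousAt
  have cp' : Continuous p' := continuous_iff_continuousAt.2 fun φ => (hp' φ).continuousAt
  have length_eq : ∀ t, L t = L 0 - 2 * Real.pi * t := fun t => by
    rw [hL t, hL 0, integral_support_sub_const cp, integral_support_sub_const cp]
    ring
  have area_eq : ∀ t, A t = A 0 - L 0 * t + Real.pi * t ^ 2 := fun t => by
    rw [hA t, hA 0, hL 0, integral_support_sub_const cp,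
      integral_support_sub_const_sq_sub_sq cp cp', integral_support_sub_const_sq_sub_sq cp cp']
    ring
  refine ⟨length_eq, area_eq, fun t => ?_⟩
  rw [length_eq t, area_eq t]
  ring
end

section
/- Let p : ℝ → ℝ be continuously differentiable and 2π-periodic. Then (∫₀^{2π} p(φ) dφ)² ≥ 2π·∫₀^{2π} (p(φ)² − p'(φ)²) dφ. In particular, for a closed convex curve with support function p, of length L = ∫₀^{2π} p dφ and enclosed area A = (1/2)·∫₀^{2π} (p² − p'²) dφ, the isoperimetric inequality L² ≥ 4πA holds. -/
open Real intervalIntegral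

/-- A nonconstant Fourier coefficient of a differentiable function with equal values at `0` and
`2π` is bounded in norm by the same coefficient of the derivative. -/
lemma norm_fourierCoeffOn_le_deriv {f f' : ℝ → ℂ} (hf : ∀ x, HasDerivAt f (f' x) x)
    (hf' : Continuous f') (hper : f (2 * π) = f 0) {n : ℤ} (hn : n ≠ 0) :
    ‖fourierCoeffOn two_pi_pos f n‖ ≤ ‖fourierCoeffOn two_pi_pos f' n‖ := by
  have hn1 : (1 : ℝ) ≤ |(n : ℝ)| := by exact_mod_cast Int.one_le_abs hn
  rw [fourierCoeffOn_of_hasDerivAt two_pi_pos hn (fun x _ => hf x)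
    (hf'.intervalIntegrable _ _), hper]
  simp only [sub_self, mul_zero, zero_sub, norm_mul, norm_neg, norm_div, norm_one,
    Complex.ofReal_zero, sub_zero, Complex.ofReal_mul, Complex.norm_real, Complex.norm_I,
    Complex.norm_intCast, Complex.ofReal_ofNat, Complex.norm_ofNat, norm_eq_abs,
    abs_of_pos pi_pos, mul_one]
  rw [← mul_assoc]
  refine mul_le_of_le_one_left (norm_nonneg _) ?_
  rw [one_div, inv_mul_le_one₀ (by positivity)]
  exact le_mul_of_one_le_right (by positivity) hn1

/-- **Parseval's identity** on `[0, 2π]` for continuous real functions. -/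
lemma hasSum_sq_fourierCoeffOn_ofReal {g : ℝ → ℝ} (hg : Continuous g) :
    HasSum (fun n => ‖fourierCoeffOn two_pi_pos (fun x => (g x : ℂ)) n‖ ^ 2)
      ((2 * π)⁻¹ * ∫ x in (0 : ℝ)..(2 * π), g x ^ 2) := by
  have hc : Continuous fun x => (g x : ℂ) := Complex.continuous_ofReal.comp hg
  have hL2 : MeasureTheory.MemLp (fun x => (g x : ℂ)) 2
      (MeasureTheory.volume.restrict (Set.Ioc 0 (2 * π))) :=
    (MeasureTheory.memLp_two_iff_integrable_sq_norm hc.aestronglyMeasurable).2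
      ((hc.norm.pow 2).integrableOn_Ioc)
  simpa using hasSum_sq_fourierCoeffOn two_pi_pos hL2

/-- The constant Fourier coefficient on `[0, 2π]` is the mean value. -/
lemma norm_fourierCoeffOn_zero_ofReal_sq (g : ℝ → ℝ) :
    ‖fourierCoeffOn two_pi_pos (fun x => (g x : ℂ)) 0‖ ^ 2 =
      ((2 * π)⁻¹ * ∫ x in (0 : ℝ)..(2 * π), g x) ^ 2 := by
  rw [fourierCoeffOn_eq_integral]
  simp [intervalIntegral.integral_ofReal, mul_pow]

/-- **Wirtinger's inequality**, without normalization of the mean. -/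
lemma two_pi_mul_integral_sq_sub_deriv_sq_le {p p' : ℝ → ℝ} (hp : ∀ x, HasDerivAt p (p' x) x)
    (hp' : Continuous p') (hper : p (2 * π) = p 0) :
    2 * π * ∫ x in (0 : ℝ)..(2 * π), (p x ^ 2 - p' x ^ 2) ≤
      (∫ x in (0 : ℝ)..(2 * π), p x) ^ 2 := by
  have hpc : Continuous p := continuous_iff_continuousAt.2 fun x => (hp x).continuousAt
  have hle := hasSum_le (fun n => ?_) (hasSum_sq_fourierCoeffOn_ofReal hpc)
    ((hasSum_ite_eq (0 : ℤ) (((2 * π)⁻¹ * ∫ x in (0 : ℝ)..(2 * π), p x) ^ 2)).add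
      (hasSum_sq_fourierCoeffOn_ofReal hp'))
  · rw [intervalIntegral.integral_sub (Continuous.intervalIntegrable (by fun_prop) _ _)
      (Continuous.intervalIntegrable (by fun_prop) _ _)]
    have hmul := mul_le_mul_of_nonneg_left hle (sq_nonneg (2 * π))
    have hpi : π ≠ 0 := pi_ne_zero
    field_simp at hmul
    linarith
  · split_ifs with hn
    · subst hn
      rw [norm_fourierCoeffOn_zero_ofReal_sq]
      exact le_add_of_nonneg_right (sq_nonneg _)
    · rw [zero_add]
      gcongr
      exact norm_fourierCoeffOn_le_deriv (fun x => (hp x).ofReal_comp)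
        (Complex.continuous_ofReal.comp hp') (by rw [hper]) hn

/-- For any `C¹`, `2π`-periodic support function `p`,
`(∫₀^{2π} p)² ≥ 2π·∫₀^{2π}(p² − p'²)`; that is, the isoperimetric inequality `L² ≥ 4πA`
holds for a closed convex curve of length `L = ∫₀^{2π} p` and area
`A = (1/2)∫₀^{2π}(p² − p'²)`. -/
theorem isoperimetric_inequality_support_function
    (p p' : ℝ → ℝ)
    (hp : ∀ φ, HasDerivAt p (p' φ) φ)
    (hC1 : Continuous p')
    (hper : ∀ φ, p (φ + 2 * Real.pi) = p φ)
    (L A : ℝ)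
    (hL : L = ∫ φ in (0 : ℝ)..(2 * Real.pi), p φ)
    (hA : A = (1 / 2) * ∫ φ in (0 : ℝ)..(2 * Real.pi), (p φ ^ 2 - p' φ ^ 2)) :
    (∫ φ in (0 : ℝ)..(2 * Real.pi), p φ) ^ 2
      ≥ 2 * Real.pi * ∫ φ in (0 : ℝ)..(2 * Real.pi), (p φ ^ 2 - p' φ ^ 2) ∧
    L ^ 2 ≥ 4 * Real.pi * A := by
  have h := two_pi_mul_integral_sq_sub_deriv_sq_le hp hC1 (by simpa using hper 0)
  refine ⟨h, ?_⟩
  rw [hL, hA]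
  linarith
end

section
/- Let ℓ > 0, T > 0, and let x, y, θ : ℝ → ℝ be continuously differentiable with x(T) = x(0), y(T) = y(0), θ(T) = θ(0) + 2π, and satisfying the bicycle constraint cos θ(t)·y'(t) − sin θ(t)·x'(t) = 0 for all t ∈ [0,T]. Define the front track X(t) = x(t) + ℓ·cos θ(t), Y(t) = y(t) + ℓ·sin θ(t), its length L_F = ∫₀ᵀ √(X'(t)² + Y'(t)²) dt, and the signed areas A_F = (1/2)·∫₀ᵀ (X·Y' − Y·X') dt and A_R = (1/2)·∫₀ᵀ (x·y' − y·x') dt. Then: (a) ∫₀ᵀ (cos θ(t)·Y'(t) − sin θ(t)·X'(t)) dt = 2πℓ; (b) L_F ≥ 2πℓ; (c) A_F − A_R = π·ℓ²; and hence (d) L_F² ≥ 4π·(A_F − A_R). -/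
open Real intervalIntegral

/-- For a closed bicycle motion (closed rear track, total turning `2π`, bicycle
constraint satisfied): (a) the perpendicular component of the front-wheel motion
integrates to `2πℓ`; (b) the front track has length `L_F ≥ 2πℓ`; (c) `A_F − A_R = πℓ²`;
hence (d) `L_F² ≥ 4π(A_F − A_R)`. -/
theorem closed_bicycle_motion_isoperimetric
    (ℓ : ℝ) (hℓ : 0 < ℓ) (T : ℝ) (hT : 0 < T)
    (x y θ x' y' θ' : ℝ → ℝ)
    (hx : ∀ t, HasDerivAt x (x' t) t)
    (hy : ∀ t, HasDerivAt y (y' t) t)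
    (hθ : ∀ t, HasDerivAt θ (θ' t) t)
    (hx' : Continuous x') (hy' : Continuous y') (hθ' : Continuous θ')
    (hxT : x T = x 0) (hyT : y T = y 0)
    (hθT : θ T = θ 0 + 2 * Real.pi)
    (hconstraint : ∀ t ∈ Set.Icc (0 : ℝ) T,
      Real.cos (θ t) * y' t - Real.sin (θ t) * x' t = 0)
    (X Y : ℝ → ℝ)
    (hX : ∀ t, X t = x t + ℓ * Real.cos (θ t))
    (hY : ∀ t, Y t = y t + ℓ * Real.sin (θ t))
    (LF AF AR : ℝ)
    (hLF : LF = ∫ t in (0 : ℝ)..T, Real.sqrt ((deriv X t) ^ 2 + (deriv Y t) ^ 2))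
    (hAF : AF = (1 / 2) * ∫ t in (0 : ℝ)..T, (X t * deriv Y t - Y t * deriv X t))
    (hAR : AR = (1 / 2) * ∫ t in (0 : ℝ)..T, (x t * y' t - y t * x' t)) :
    (∫ t in (0 : ℝ)..T, (Real.cos (θ t) * deriv Y t - Real.sin (θ t) * deriv X t))
        = 2 * Real.pi * ℓ ∧
    LF ≥ 2 * Real.pi * ℓ ∧
    AF - AR = Real.pi * ℓ ^ 2 ∧
    LF ^ 2 ≥ 4 * Real.pi * (AF - AR) := by
  have hcx : Continuous x := continuous_iff_continuousAt.2 fun t => (hx t).continuousAt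
  have hcy : Continuous y := continuous_iff_continuousAt.2 fun t => (hy t).continuousAt
  have hcθ : Continuous θ := continuous_iff_continuousAt.2 fun t => (hθ t).continuousAt
  have hdX : deriv X = fun t => x' t + ℓ * (-Real.sin (θ t) * θ' t) := by
    ext t
    rw [funext hX]
    exact ((hx t).add ((hθ t).cos.const_mul ℓ)).deriv
  have hdY : deriv Y = fun t => y' t + ℓ * (Real.cos (θ t) * θ' t) := by
    ext t
    rw [funext hY]
    exact ((hy t).add ((hθ t).sin.const_mul ℓ)).deriv
  have hcdX : Continuous (deriv X) := by rw [hdX]; fun_prop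
  have hcdY : Continuous (deriv Y) := by rw [hdY]; fun_prop
  have hcX : Continuous X := by rw [funext hX]; fun_prop
  have hcY : Continuous Y := by rw [funext hY]; fun_prop
  have hperp : (∫ t in (0 : ℝ)..T, (Real.cos (θ t) * deriv Y t - Real.sin (θ t) * deriv X t))
      = 2 * Real.pi * ℓ := by
    rw [integral_eq_sub_of_hasDerivAt (f := fun t => ℓ * θ t)]
    · rw [hθT]; ring
    · intro t ht
      rw [Set.uIcc_of_le hT.le] at ht
      refine ((hθ t).const_mul ℓ).congr_deriv ?_
      simp only [hdX, hdY]
      linear_combination -hconstraint t ht - ℓ * θ' t * Real.sin_sq_add_cos_sq (θ t)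
    · exact Continuous.intervalIntegrable (by fun_prop) _ _
  have hlength : 2 * Real.pi * ℓ ≤ LF := by
    rw [hLF, ← hperp]
    refine integral_mono_on hT.le (Continuous.intervalIntegrable (by fun_prop) _ _)
      (Continuous.intervalIntegrable (by fun_prop) _ _) fun t _ => ?_
    apply Real.le_sqrt_of_sq_le
    have h := sq_nonneg (Real.cos (θ t) * deriv X t + Real.sin (θ t) * deriv Y t)
    linear_combination h + (deriv X t ^ 2 + deriv Y t ^ 2) * Real.sin_sq_add_cos_sq (θ t)
  have harea : AF - AR = Real.pi * ℓ ^ 2 := by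
    rw [hAF, hAR, ← mul_sub, ← integral_sub (Continuous.intervalIntegrable (by fun_prop) _ _)
      (Continuous.intervalIntegrable (by fun_prop) _ _), integral_eq_sub_of_hasDerivAt
      (f := fun t => ℓ * (x t * Real.sin (θ t) - y t * Real.cos (θ t)) + ℓ ^ 2 * θ t)]
    · simp only [hθT, hxT, hyT, Real.sin_add_two_pi, Real.cos_add_two_pi]; ring
    · intro t ht
      rw [Set.uIcc_of_le hT.le] at ht
      refine (((((hx t).mul (hθ t).sin).sub ((hy t).mul (hθ t).cos)).const_mul ℓ).add
        ((hθ t).const_mul (ℓ ^ 2))).congr_deriv ?_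
      simp only [hdX, hdY, hX, hY]
      linear_combination -2 * ℓ * hconstraint t ht -
        ℓ ^ 2 * θ' t * Real.sin_sq_add_cos_sq (θ t)
    · exact Continuous.intervalIntegrable (by fun_prop) _ _
  refine ⟨hperp, hlength, harea, ?_⟩
  have hsq := pow_le_pow_left₀ (by positivity) hlength 2
  rw [harea]
  linear_combination hsq
end
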